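/- arXiv:2311.10307 — 8 statements merged into one kernel-verified Lean document; each statement's English description precedes it below -/
import Mathlib

section
/- Let 𝒳 be a finite set, x ↦ W_x a pure-state classical–quantum channel on ℂ^d, and P a probability distribution on 𝒳. Then for every ε ∈ (0,1) and δ ∈ (0,1) with ε + 2δ < 1, the information-spectrum relative entropy satisfies D_s^ε(R[P] ‖ S[P, W_P]) ≤ H_s^{ε+2δ}(W_P) + 2 log(1/δ). -/
open scoped ComplexOrder

/-- Projection onto the sum of eigenspaces of a Hermitian matrix with nonnegative
eigenvalues (junk value `0` if the matrix is not Hermitian). -/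
noncomputable def projNonneg {n : Type*} [Fintype n] [DecidableEq n]
    (A : Matrix n n ℂ) : Matrix n n ℂ :=
  if hA : A.IsHermitian then
    (hA.eigenvectorUnitary : Matrix n n ℂ) *
      Matrix.diagonal (fun i => if 0 ≤ hA.eigenvalues i then (1 : ℂ) else 0) *
      star (hA.eigenvectorUnitary : Matrix n n ℂ)
  else 0

/-- A pure state: a rank-one orthogonal projection, equivalently a Hermitian
idempotent of trace one. -/
def IsPureState {n : Type*} [Fintype n] (ρ : Matrix n n ℂ) : Prop :=
  ρ.IsHermitian ∧ ρ * ρ = ρ ∧ ρ.trace = 1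

/-- A state: a positive semidefinite matrix of trace one. -/
def IsState {n : Type*} [Fintype n] (ρ : Matrix n n ℂ) : Prop :=
  ρ.PosSemidef ∧ ρ.trace = 1

/-- `H_s^ε(ρ) = sup {λ | tr(ρ {ρ ≥ e^{-λ} I}) ≤ ε}`. -/
noncomputable def Hs {n : Type*} [Fintype n] [DecidableEq n]
    (ε : ℝ) (ρ : Matrix n n ℂ) : ℝ :=
  sSup {lam : ℝ |
    ((ρ * projNonneg (ρ - Real.exp (-lam) • (1 : Matrix n n ℂ))).trace).re ≤ ε}

/-- Information-spectrum relative entropy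
`D_s^δ(ρ‖σ) = sup {λ | tr(ρ {ρ ≤ e^λ σ}) ≤ δ}`. -/
noncomputable def Ds {n : Type*} [Fintype n] [DecidableEq n]
    (δ : ℝ) (ρ σ : Matrix n n ℂ) : ℝ :=
  sSup {lam : ℝ |
    ((ρ * projNonneg (Real.exp lam • σ - ρ)).trace).re ≤ δ}

/-- The average state `W_P = Σ_x P(x) W_x`. -/
noncomputable def WPavg {X : Type*} [Fintype X] {n : Type*} [Fintype n]
    (P : X → ℝ) (W : X → Matrix n n ℂ) : Matrix n n ℂ :=
  ∑ x, (P x : ℂ) • W x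

/-- The classical-quantum state `R[P] = Σ_x P(x) |x⟩⟨x| ⊗ W_x`. -/
noncomputable def Rcq {X : Type*} [DecidableEq X] {n : Type*}
    (P : X → ℝ) (W : X → Matrix n n ℂ) : Matrix (X × n) (X × n) ℂ :=
  Matrix.of fun p q => if p.1 = q.1 then (P p.1 : ℂ) * W p.1 p.2 q.2 else 0

/-- The product state `S[P,ρ] = (Σ_x P(x)|x⟩⟨x|) ⊗ ρ`. -/
noncomputable def Scq {X : Type*} [DecidableEq X] {n : Type*}
    (P : X → ℝ) (ρ : Matrix n n ℂ) : Matrix (X × n) (X × n) ℂ :=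
  Matrix.of fun p q => if p.1 = q.1 then (P p.1 : ℂ) * ρ p.2 q.2 else 0

open scoped Kronecker Matrix

section Projection

variable {n : Type*} [Fintype n] [DecidableEq n] {A B : Matrix n n ℂ}

lemma Matrix.IsHermitian.eq_eigenvectorUnitary_conj (hA : A.IsHermitian) :
    A = (hA.eigenvectorUnitary : Matrix n n ℂ) *
      Matrix.diagonal (fun i => (hA.eigenvalues i : ℂ)) *
      star (hA.eigenvectorUnitary : Matrix n n ℂ) := by
  conv_lhs => rw [hA.spectral_theorem]
  simp [Unitary.conjStarAlgAut_apply, Function.comp_def]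

lemma Matrix.IsHermitian.eigenvectorUnitary_conj_mul (hA : A.IsHermitian) (v w : n → ℂ) :
    ((hA.eigenvectorUnitary : Matrix n n ℂ) * Matrix.diagonal v *
        star (hA.eigenvectorUnitary : Matrix n n ℂ)) *
      ((hA.eigenvectorUnitary : Matrix n n ℂ) * Matrix.diagonal w *
        star (hA.eigenvectorUnitary : Matrix n n ℂ)) =
    (hA.eigenvectorUnitary : Matrix n n ℂ) * Matrix.diagonal (fun i => v i * w i) *
      star (hA.eigenvectorUnitary : Matrix n n ℂ) := by
  have h := Unitary.coe_star_mul_self hA.eigenvectorUnitary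
  rw [← Matrix.diagonal_mul_diagonal]
  simp only [Matrix.mul_assoc]
  rw [← Matrix.mul_assoc (star (hA.eigenvectorUnitary : Matrix n n ℂ)), h, Matrix.one_mul]

lemma Matrix.IsHermitian.posSemidef_eigenvectorUnitary_conj (hA : A.IsHermitian) {v : n → ℂ}
    (hv : ∀ i, 0 ≤ v i) :
    ((hA.eigenvectorUnitary : Matrix n n ℂ) * Matrix.diagonal v *
      star (hA.eigenvectorUnitary : Matrix n n ℂ)).PosSemidef :=
  (Matrix.PosSemidef.diagonal hv).mul_mul_conjTranspose_same _

lemma projNonneg_posSemidef (hA : A.IsHermitian) : (projNonneg A).PosSemidef := by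
  rw [projNonneg, dif_pos hA]
  refine hA.posSemidef_eigenvectorUnitary_conj fun i => ?_
  split_ifs <;> simp

lemma projNonneg_mul_self (hA : A.IsHermitian) :
    projNonneg A * projNonneg A = projNonneg A := by
  rw [projNonneg, dif_pos hA, hA.eigenvectorUnitary_conj_mul]
  simp only [← ite_and, mul_ite, mul_one, mul_zero, and_self]

lemma mul_projNonneg_posSemidef (hA : A.IsHermitian) : (A * projNonneg A).PosSemidef := by
  have h : A * projNonneg A = (hA.eigenvectorUnitary : Matrix n n ℂ) *
      Matrix.diagonal (fun i => hA.eigenvalues i * (if 0 ≤ hA.eigenvalues i then (1 : ℂ) else 0)) *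
      star (hA.eigenvectorUnitary : Matrix n n ℂ) := by
    rw [← hA.eigenvectorUnitary_conj_mul, ← hA.eq_eigenvectorUnitary_conj, projNonneg, dif_pos hA]
  rw [h]
  refine hA.posSemidef_eigenvectorUnitary_conj fun i => ?_
  split_ifs with h
  · simpa using h
  · simp

lemma mul_projNonneg_sub_posSemidef (hA : A.IsHermitian) :
    (A * projNonneg A - A).PosSemidef := by
  have h : A * projNonneg A - A = (hA.eigenvectorUnitary : Matrix n n ℂ) *
      Matrix.diagonal (fun i => hA.eigenvalues i * (if 0 ≤ hA.eigenvalues i then (1 : ℂ) else 0)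
        - hA.eigenvalues i) * star (hA.eigenvectorUnitary : Matrix n n ℂ) := by
    rw [← Matrix.diagonal_sub, Matrix.mul_sub, Matrix.sub_mul, ← hA.eigenvectorUnitary_conj_mul,
      ← hA.eq_eigenvectorUnitary_conj, projNonneg, dif_pos hA]
  rw [h]
  refine hA.posSemidef_eigenvectorUnitary_conj fun i => ?_
  split_ifs with h
  · simp
  · have : (hA.eigenvalues i : ℂ) ≤ 0 := by exact_mod_cast (not_le.mp h).le
    simpa using this

lemma Commute.projNonneg_right (hA : A.IsHermitian) (h : Commute B A) :
    Commute B (projNonneg A) := by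
  set U := (hA.eigenvectorUnitary : Matrix n n ℂ)
  have h1 : star U * U = 1 := Unitary.coe_star_mul_self hA.eigenvectorUnitary
  have h2 : U * star U = 1 := Unitary.coe_mul_star_self hA.eigenvectorUnitary
  have hAd : A = U * Matrix.diagonal (fun i => (hA.eigenvalues i : ℂ)) * star U :=
    hA.eq_eigenvectorUnitary_conj
  set M := star U * B * U with hM
  have hB : B = U * M * star U := by
    calc B = (U * star U) * B * (U * star U) := by simp [h2]
      _ = _ := by simp only [hM, Matrix.mul_assoc]
  have conj_mul (C D : Matrix n n ℂ) : U * C * star U * (U * D * star U) = U * (C * D) * star U := by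
    calc _ = U * C * (star U * U) * D * star U := by simp only [Matrix.mul_assoc]
      _ = _ := by simp only [h1, Matrix.mul_one, Matrix.mul_assoc]
  have unconj (C : Matrix n n ℂ) : star U * (U * C * star U) * U = C := by
    calc _ = (star U * U) * C * (star U * U) := by simp only [Matrix.mul_assoc]
      _ = _ := by simp [h1]
  have hcomm : M * Matrix.diagonal (fun i => (hA.eigenvalues i : ℂ)) =
      Matrix.diagonal (fun i => (hA.eigenvalues i : ℂ)) * M := by
    have h3 : B * A = A * B := h
    rw [hB, hAd, conj_mul, conj_mul] at h3
    rw [← unconj (M * _), h3, unconj]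
  have hQ : projNonneg A = U *
      Matrix.diagonal (fun i => if 0 ≤ hA.eigenvalues i then (1 : ℂ) else 0) * star U := by
    rw [projNonneg, dif_pos hA]
  rw [Commute, SemiconjBy, hQ, hB, conj_mul, conj_mul]
  congr 2
  ext i j
  have hij := congrFun (congrFun hcomm i) j
  rw [Matrix.mul_diagonal, Matrix.diagonal_mul] at hij ⊢
  by_cases hM0 : M i j = 0
  · simp [hM0]
  · have : hA.eigenvalues j = hA.eigenvalues i := by
      have := mul_right_cancel₀ hM0 ((mul_comm _ _).trans hij)
      exact_mod_cast this
    rw [this, mul_comm]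

/-- A positive semidefinite `A` dominates `t` times the spectral projection `{A ≥ t}`. -/
lemma posSemidef_sub_smul_projNonneg (hA : A.PosSemidef) {t : ℝ} :
    (A - t • projNonneg (A - t • (1 : Matrix n n ℂ))).PosSemidef := by
  have hB : (A - t • (1 : Matrix n n ℂ)).IsHermitian := by
    refine hA.1.sub ?_
    simp [Matrix.IsHermitian, Matrix.conjTranspose_smul]
  set Q := projNonneg (A - t • (1 : Matrix n n ℂ))
  have hQQ : Q * Q = Q := projNonneg_mul_self hB
  have hQH : Qᴴ = Q := (projNonneg_posSemidef hB).1
  have hc : A * Q = Q * A := by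
    refine Commute.projNonneg_right hB ?_
    exact (Commute.refl A).sub_right ((Commute.one_right A).smul_right t)
  have h1 : ((A - t • (1 : Matrix n n ℂ)) * Q).PosSemidef := mul_projNonneg_posSemidef hB
  have h2 := hA.conjTranspose_mul_mul_same (1 - Q)
  rw [Matrix.conjTranspose_sub, Matrix.conjTranspose_one, hQH] at h2
  convert h1.add h2 using 1
  simp only [sub_mul, mul_sub, one_mul, mul_one, smul_mul_assoc]
  rw [mul_assoc Q A Q, hc, ← mul_assoc Q Q A, hQQ]
  abel

end Projection

section TraceInequality

variable {n : Type*} [Fintype n]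

lemma Matrix.PosSemidef.re_trace_nonneg {A : Matrix n n ℂ} (hA : A.PosSemidef) :
    0 ≤ A.trace.re :=
  (Complex.le_def.mp hA.trace_nonneg).1

/-- Cauchy–Schwarz for the Hilbert–Schmidt inner product. -/
lemma Matrix.sq_re_trace_conjTranspose_mul_le (A B : Matrix n n ℂ) :
    (Aᴴ * B).trace.re ^ 2 ≤ (Aᴴ * A).trace.re * (Bᴴ * B).trace.re := by
  have hsym : (Bᴴ * A).trace.re = (Aᴴ * B).trace.re := by
    have h : (Bᴴ * A) = (Aᴴ * B)ᴴ := by simp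
    rw [h, Matrix.trace_conjTranspose]
    simp
  have h (x : ℝ) : 0 ≤ (Aᴴ * A).trace.re * (x * x) + (2 * (Aᴴ * B).trace.re) * x
      + (Bᴴ * B).trace.re := by
    have := (Matrix.posSemidef_conjTranspose_mul_self (x • A + B)).re_trace_nonneg
    simp only [Matrix.conjTranspose_add, Matrix.conjTranspose_smul, add_mul, mul_add,
      Matrix.smul_mul, Matrix.mul_smul, Matrix.trace_add, Matrix.trace_smul, Complex.add_re,
      Complex.smul_re, smul_eq_mul, star_trivial, hsym] at this
    linarith
  have := discrim_le_zero h
  rw [discrim] at this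
  linarith

/-- If `N` and `Q` are projections and `Q` nearly annihilates `N K`, then `Q` and `N` are nearly
orthogonal as tests on the state `K * K`. -/
lemma re_trace_mul_projection_le [DecidableEq n] {K N Q : Matrix n n ℂ} {δ : ℝ}
    (hδ : 0 ≤ δ) (hδ1 : δ ≤ 1)
    (hK : Kᴴ = K) (hN : Nᴴ = N) (hNN : N * N = N) (hQ : Qᴴ = Q) (hQQ : Q * Q = Q)
    (hK1 : (K * K).trace.re = 1)
    (h : (K * N * Q * N * K).trace.re ≤ δ ^ 2 * (K * N * K).trace.re) :
    (K * K * Q).trace.re ≤ 1 - (K * K * N).trace.re + 2 * δ := by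
  have hcyc (M : Matrix n n ℂ) : (K * M * K).trace = (K * K * M).trace := by
    rw [Matrix.trace_mul_comm, ← mul_assoc]
  have c1 := Matrix.sq_re_trace_conjTranspose_mul_le K (Q * N * K)
  have c2 := Matrix.sq_re_trace_conjTranspose_mul_le ((1 - Q) * K) (N * K)
  have e1 : (Q * N * K)ᴴ * (Q * N * K) = K * N * Q * N * K := by
    simp only [Matrix.conjTranspose_mul, hK, hN, hQ]
    calc _ = K * N * (Q * Q) * N * K := by simp only [mul_assoc]
      _ = _ := by rw [hQQ]
  have e2 : (N * K)ᴴ * (N * K) = K * N * K := by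
    simp only [Matrix.conjTranspose_mul, hK, hN]
    calc _ = K * (N * N) * K := by simp only [mul_assoc]
      _ = _ := by rw [hNN]
  have e3 : ((1 - Q) * K)ᴴ * ((1 - Q) * K) = K * K - K * Q * K := by
    simp only [Matrix.conjTranspose_mul, Matrix.conjTranspose_sub, Matrix.conjTranspose_one, hK, hQ]
    calc _ = K * K - K * Q * K - K * Q * K + K * (Q * Q) * K := by noncomm_ring
      _ = _ := by rw [hQQ]; abel
  have e4 : ((1 - Q) * K)ᴴ * (N * K) = K * N * K - K * (Q * N * K) := by
    simp only [Matrix.conjTranspose_mul, Matrix.conjTranspose_sub, Matrix.conjTranspose_one, hK, hQ]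
    noncomm_ring
  have hpos1 := (Matrix.posSemidef_conjTranspose_mul_self (N * K)).re_trace_nonneg
  have hpos2 := (Matrix.posSemidef_conjTranspose_mul_self ((1 - Q) * K)).re_trace_nonneg
  have hpos3 := (Matrix.posSemidef_conjTranspose_mul_self ((1 - N) * K)).re_trace_nonneg
  have e5 : ((1 - N) * K)ᴴ * ((1 - N) * K) = K * K - K * N * K := by
    simp only [Matrix.conjTranspose_mul, Matrix.conjTranspose_sub, Matrix.conjTranspose_one, hK, hN]
    calc _ = K * K - K * N * K - K * N * K + K * (N * N) * K := by noncomm_ring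
      _ = _ := by rw [hNN]; abel
  rw [e1, hK, hK1, one_mul] at c1
  rw [e2, e3, e4, Matrix.trace_sub, Matrix.trace_sub, Complex.sub_re, Complex.sub_re, hK1] at c2
  rw [e2] at hpos1
  rw [e3, Matrix.trace_sub, Complex.sub_re, hK1] at hpos2
  rw [e5, Matrix.trace_sub, Complex.sub_re, hK1] at hpos3
  rw [← hcyc, ← hcyc]
  set b := (K * (Q * N * K)).trace.re
  set a := Real.sqrt (1 - (K * Q * K).trace.re)
  set m := Real.sqrt (K * N * K).trace.re
  have ha2 : a ^ 2 = 1 - (K * Q * K).trace.re := Real.sq_sqrt hpos2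
  have hm2 : m ^ 2 = (K * N * K).trace.re := Real.sq_sqrt hpos1
  have ha0 : 0 ≤ a := Real.sqrt_nonneg _
  have hm0 : 0 ≤ m := Real.sqrt_nonneg _
  rw [← hm2] at h c2 hpos3
  rw [← ha2, ← mul_pow] at c2
  have hm1 : m ≤ 1 := by nlinarith
  have b1 : b ≤ δ * m := abs_le_of_sq_le_sq' (by nlinarith) (by positivity) |>.2
  have b2 : m ^ 2 - b ≤ a * m := abs_le_of_sq_le_sq' c2 (by positivity) |>.2
  have key : m ≤ a + δ := by
    rcases hm0.eq_or_lt with h0 | h0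
    · rw [← h0]; positivity
    · refine le_of_mul_le_mul_right ?_ h0
      nlinarith
  rw [← hm2]
  have : m ^ 2 - 2 * δ ≤ a ^ 2 := by
    rcases le_total m δ with h1 | h1
    · nlinarith
    · nlinarith [mul_nonneg hδ (sub_nonneg.2 hm1)]
  linarith

/-- Abstract form of the comparison, for `N` a projection onto which the compression of
`E * (Π - c s) * E` is positive. -/
lemma re_trace_projection_le_of_compression [DecidableEq n] {E Pi N Q s : Matrix n n ℂ} {δ c t : ℝ}
    (hδ : 0 < δ) (hδ1 : δ ≤ 1) (hc : 0 < c) (hct : c * t * δ ^ 2 = 1)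
    (hE : Eᴴ = E) (hPi : Piᴴ = Pi) (hPiPi : Pi * Pi = Pi)
    (hN : Nᴴ = N) (hNN : N * N = N) (hQ : Qᴴ = Q) (hQQ : Q * Q = Q)
    (hEPi : Commute E Pi) (hEN : Commute E N)
    (htr : (E * E * Pi).trace.re = 1) (hs : (s - t • Q).PosSemidef)
    (hpos : (N * (E * (Pi - c • s) * E) * N).PosSemidef) :
    (E * E * Pi * Q).trace.re ≤ 1 - (E * E * Pi * N).trace.re + 2 * δ := by
  have hK : (E * Pi)ᴴ = E * Pi := by rw [Matrix.conjTranspose_mul, hE, hPi, hEPi.eq]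
  have hKK : E * Pi * (E * Pi) = E * E * Pi := by
    calc _ = E * (Pi * E) * Pi := by simp only [mul_assoc]
      _ = E * E * (Pi * Pi) := by rw [← hEPi.eq]; simp only [mul_assoc]
      _ = _ := by rw [hPiPi]
  rw [← hKK]
  refine re_trace_mul_projection_le hδ.le hδ1 hK hN hNN hQ hQQ (by rw [hKK, htr]) ?_
  set K := E * Pi with hKdef
  have h1 := (hpos.conjTranspose_mul_mul_same Pi).re_trace_nonneg
  have h2 := (hs.conjTranspose_mul_mul_same (N * K)).re_trace_nonneg
  have h3 := (Matrix.posSemidef_conjTranspose_mul_self ((1 - Pi) * (N * K))).re_trace_nonneg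
  have e1 : Piᴴ * (N * (E * (Pi - c • s) * E) * N) * Pi
      = K * N * Pi * N * K - c • (K * N * s * N * K) := by
    rw [hPi]
    calc _ = Pi * (N * E) * (Pi - c • s) * (E * N) * Pi := by simp only [mul_assoc]
      _ = (Pi * E) * N * (Pi - c • s) * N * (E * Pi) := by
        rw [hEN.eq, ← hEN.eq]
        nth_rw 2 [hEN.eq]
        simp only [mul_assoc]
      _ = _ := by
        rw [← hEPi.eq, ← hKdef]
        simp only [mul_sub, sub_mul, mul_smul_comm, smul_mul_assoc, mul_assoc]
  have e2 : (N * K)ᴴ * (s - t • Q) * (N * K) = K * N * s * N * K - t • (K * N * Q * N * K) := by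
    rw [Matrix.conjTranspose_mul, hK, hN]
    simp only [mul_sub, sub_mul, mul_smul_comm, smul_mul_assoc, mul_assoc]
  have e3 : ((1 - Pi) * (N * K))ᴴ * ((1 - Pi) * (N * K)) = K * N * K - K * N * Pi * N * K := by
    simp only [Matrix.conjTranspose_mul, Matrix.conjTranspose_sub, Matrix.conjTranspose_one, hK,
      hN, hPi]
    calc _ = K * (N * N) * K - K * N * Pi * N * K - K * N * Pi * N * K
          + K * N * (Pi * Pi) * N * K := by noncomm_ring
      _ = _ := by rw [hNN, hPiPi]; abel
  rw [e1] at h1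
  rw [e2] at h2
  rw [e3] at h3
  simp only [Matrix.trace_sub, Matrix.trace_smul, Complex.sub_re, Complex.smul_re,
    smul_eq_mul] at h1 h2 h3
  have h4 : c * (t * (K * N * Q * N * K).trace.re) ≤ (K * N * K).trace.re := by
    have := mul_nonneg hc.le h2
    linarith
  calc (K * N * Q * N * K).trace.re
      = δ ^ 2 * (c * (t * (K * N * Q * N * K).trace.re)) := by
        linear_combination (-(K * N * Q * N * K).trace.re) * hct
    _ ≤ _ := by gcongr

end TraceInequality

section ClassicalQuantum

variable {X n : Type*} {P : X → ℝ} {W : X → Matrix n n ℂ}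

lemma Rcq_isHermitian [DecidableEq X] (hW : ∀ x, (W x).IsHermitian) : (Rcq P W).IsHermitian := by
  ext ⟨x, i⟩ ⟨y, j⟩
  rw [Matrix.conjTranspose_apply]
  simp only [Rcq, Matrix.of_apply]
  by_cases h : x = y
  · subst h
    simp [(hW x).apply]
  · simp [h, Ne.symm h]

lemma Rcq_one_mul_self [Fintype X] [DecidableEq X] [Fintype n] (hW : ∀ x, W x * W x = W x) :
    Rcq (fun _ => 1) W * Rcq (fun _ => 1) W = Rcq (fun _ => 1) W := by
  ext ⟨x, i⟩ ⟨y, j⟩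
  simp only [Rcq, Matrix.mul_apply, Matrix.of_apply, Fintype.sum_prod_type, Complex.ofReal_one,
    one_mul]
  by_cases h : x = y
  · subst h
    conv_rhs => rw [if_pos rfl, ← hW x, Matrix.mul_apply]
    rw [Finset.sum_eq_single x]
    · simp
    · intro b _ hb
      simp [hb]
    · simp
  · rw [if_neg h]
    refine Finset.sum_eq_zero fun b _ => Finset.sum_eq_zero fun k _ => ?_
    by_cases hb : x = b
    · subst hb; simp [h]
    · simp [hb]

lemma Rcq_eq_mul [Fintype X] [DecidableEq X] [Fintype n] [DecidableEq n] (hP : ∀ x, 0 ≤ P x) :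
    Rcq P W = Matrix.diagonal (fun p : X × n => (Real.sqrt (P p.1) : ℂ)) *
      Matrix.diagonal (fun p : X × n => (Real.sqrt (P p.1) : ℂ)) * Rcq (fun _ => 1) W := by
  ext ⟨x, i⟩ ⟨y, j⟩
  rw [Matrix.diagonal_mul_diagonal, Matrix.diagonal_mul]
  simp only [Rcq, Matrix.of_apply, ← Complex.ofReal_mul, Real.mul_self_sqrt (hP x)]
  simp

lemma commute_diagonal_Rcq [Fintype X] [DecidableEq X] [Fintype n] [DecidableEq n] (f : X → ℂ) :
    Commute (Matrix.diagonal (fun p : X × n => f p.1)) (Rcq P W) := by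
  rw [Commute, SemiconjBy]
  ext ⟨x, i⟩ ⟨y, j⟩
  rw [Matrix.diagonal_mul, Matrix.mul_diagonal]
  by_cases h : x = y
  · subst h; ring
  · simp [Rcq, h]

lemma Scq_eq_Rcq [DecidableEq X] (ρ : Matrix n n ℂ) : Scq P ρ = Rcq P fun _ => ρ := rfl

lemma Rcq_one_const [DecidableEq X] (ρ : Matrix n n ℂ) :
    Rcq (fun _ => 1) (fun _ : X => ρ) = (1 : Matrix X X ℂ) ⊗ₖ ρ := by
  ext ⟨x, i⟩ ⟨y, j⟩
  simp [Rcq, Matrix.one_apply]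

lemma trace_Rcq_mul_one_kronecker [Fintype X] [DecidableEq X] [Fintype n] [DecidableEq n] (Q : Matrix n n ℂ) :
    (Rcq P W * ((1 : Matrix X X ℂ) ⊗ₖ Q)).trace = (WPavg P W * Q).trace := by
  simp only [WPavg, Finset.sum_mul, Matrix.trace_sum, Matrix.smul_mul, Matrix.trace_smul]
  simp only [Matrix.trace, Matrix.diag_apply, Matrix.mul_apply, Fintype.sum_prod_type, smul_eq_mul,
    Finset.mul_sum]
  refine Finset.sum_congr rfl fun x _ => Finset.sum_congr rfl fun i _ => ?_
  rw [Finset.sum_eq_single x]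
  · simp [Rcq, mul_assoc]
  · intro y _ hy
    simp [Rcq, Ne.symm hy]
  · simp

lemma trace_Rcq [Fintype X] [DecidableEq X] [Fintype n] [DecidableEq n] : (Rcq P W).trace = (WPavg P W).trace := by
  simpa using trace_Rcq_mul_one_kronecker (P := P) (W := W) (1 : Matrix n n ℂ)

lemma IsPureState.posSemidef [Fintype n] {ρ : Matrix n n ℂ} (h : IsPureState ρ) : ρ.PosSemidef := by
  have := Matrix.posSemidef_conjTranspose_mul_self ρ
  rwa [h.1.eq, h.2.1] at this

lemma WPavg_isState [Fintype X] [Fintype n] (hW : ∀ x, IsState (W x)) (hP0 : ∀ x, 0 ≤ P x) (hP1 : ∑ x, P x = 1) :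
    IsState (WPavg P W) := by
  refine ⟨Matrix.posSemidef_sum _ fun x _ => (hW x).1.smul (by exact_mod_cast hP0 x), ?_⟩
  simp only [WPavg, Matrix.trace_sum, Matrix.trace_smul, (hW _).2, smul_eq_mul, mul_one]
  exact_mod_cast hP1

lemma Rcq_isState [Fintype X] [DecidableEq X] [Fintype n] [DecidableEq n]
    (hW : ∀ x, IsState (W x)) (hP0 : ∀ x, 0 ≤ P x) (hP1 : ∑ x, P x = 1) :
    IsState (Rcq P W) := by
  refine ⟨Matrix.PosSemidef.of_dotProduct_mulVec_nonneg (Rcq_isHermitian fun x => (hW x).1.1)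
    fun v => ?_, by rw [trace_Rcq, (WPavg_isState hW hP0 hP1).2]⟩
  have h : star v ⬝ᵥ (Rcq P W *ᵥ v) =
      ∑ x, (P x : ℂ) * (star (fun i => v (x, i)) ⬝ᵥ (W x *ᵥ fun i => v (x, i))) := by
    simp only [dotProduct, Matrix.mulVec, Fintype.sum_prod_type, Finset.mul_sum]
    refine Finset.sum_congr rfl fun x _ => Finset.sum_congr rfl fun i _ => ?_
    rw [Finset.sum_eq_single x]
    · refine Finset.sum_congr rfl fun j _ => ?_
      simp only [Rcq, Matrix.of_apply, if_true, Pi.star_apply]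
      ring
    · intro y _ hy
      simp [Rcq, Ne.symm hy]
    · simp
  rw [h]
  exact Finset.sum_nonneg fun x _ =>
    mul_nonneg (by exact_mod_cast hP0 x) ((hW x).1.dotProduct_mulVec_nonneg _)

end ClassicalQuantum

section InformationSpectrum

variable {n : Type*} [Fintype n] [DecidableEq n]

lemma Hs_bddAbove {ρ : Matrix n n ℂ} (hρ : IsState ρ) {ε : ℝ} (hε : ε < 1) :
    BddAbove {lam : ℝ |
      ((ρ * projNonneg (ρ - Real.exp (-lam) • (1 : Matrix n n ℂ))).trace).re ≤ ε} := by
  refine ⟨Real.log (Fintype.card n / (1 - ε)), fun lam hlam => ?_⟩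
  rw [Set.mem_ofPred_eq] at hlam
  have hA : (ρ - Real.exp (-lam) • (1 : Matrix n n ℂ)).IsHermitian :=
    hρ.1.1.sub (by simp [Matrix.IsHermitian, Matrix.conjTranspose_smul])
  have h1 := (mul_projNonneg_sub_posSemidef hA).re_trace_nonneg
  have h2 := (projNonneg_posSemidef hA).re_trace_nonneg
  set Q := projNonneg (ρ - Real.exp (-lam) • (1 : Matrix n n ℂ))
  simp only [sub_mul, smul_mul_assoc, one_mul, Matrix.trace_sub, Matrix.trace_smul, hρ.2,
    Complex.sub_re, Complex.smul_re, smul_eq_mul, Matrix.trace_one, Complex.natCast_re,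
    Complex.one_re] at h1
  have h3 : 1 - ε ≤ Real.exp (-lam) * Fintype.card n := by
    have := mul_nonneg (Real.exp_pos (-lam)).le h2
    linarith
  have hg : 0 < 1 - ε := by linarith
  have hd : (0 : ℝ) < Fintype.card n := pos_of_mul_pos_right (hg.trans_le h3) (Real.exp_pos _).le
  rw [Real.le_log_iff_exp_le (by positivity), le_div_iff₀ hg]
  calc Real.exp lam * (1 - ε) ≤ Real.exp lam * (Real.exp (-lam) * Fintype.card n) := by gcongr
    _ = _ := by rw [← mul_assoc, ← Real.exp_add]; simp

lemma log_mem_Ds_set {ρ σ : Matrix n n ℂ} (hρ : ρ.IsHermitian) (hσ : IsState σ) {ε : ℝ}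
    (hε : 0 < ε) :
    Real.log ε ∈ {lam : ℝ | ((ρ * projNonneg (Real.exp lam • σ - ρ)).trace).re ≤ ε} := by
  rw [Set.mem_ofPred_eq, Real.exp_log hε]
  have hA : (ε • σ - ρ).IsHermitian :=
    Matrix.IsHermitian.sub (by simp [Matrix.IsHermitian, Matrix.conjTranspose_smul, hσ.1.1.eq]) hρ
  have h1 := (mul_projNonneg_posSemidef hA).re_trace_nonneg
  have hQ := (projNonneg_posSemidef hA).1.eq
  have hQQ := projNonneg_mul_self hA
  set Q := projNonneg (ε • σ - ρ)
  have h2 := (hσ.1.conjTranspose_mul_mul_same (1 - Q)).re_trace_nonneg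
  rw [Matrix.trace_mul_comm, ← mul_assoc, Matrix.conjTranspose_sub, Matrix.conjTranspose_one, hQ,
    Matrix.trace_mul_comm] at h2
  have e : σ * ((1 - Q) * (1 - Q)) = σ - σ * Q := by
    calc _ = σ - σ * Q - σ * Q + σ * (Q * Q) := by noncomm_ring
      _ = _ := by rw [hQQ]; abel
  rw [e] at h2
  simp only [sub_mul, smul_mul_assoc, Matrix.trace_sub, Matrix.trace_smul, hσ.2, Complex.sub_re,
    Complex.smul_re, smul_eq_mul, Complex.one_re] at h1 h2
  nlinarith

/-- For a channel of projections, passing the test `{R ≤ e^λ S}` with small probability forces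
`{W_P ≥ t}` to be passed with small probability, `t = e^{-λ} δ^{-2}`. -/
lemma re_trace_WPavg_mul_projNonneg_le {X : Type*} [Fintype X] [DecidableEq X]
    {W : X → Matrix n n ℂ} (hW : ∀ x, IsPureState (W x))
    {P : X → ℝ} (hP0 : ∀ x, 0 ≤ P x) (hP1 : ∑ x, P x = 1)
    {δ c t : ℝ} (hδ : 0 < δ) (hδ1 : δ ≤ 1) (hc : 0 < c) (hct : c * t * δ ^ 2 = 1) :
    (WPavg P W * projNonneg (WPavg P W - t • (1 : Matrix n n ℂ))).trace.re ≤
      (Rcq P W * projNonneg (c • Scq P (WPavg P W) - Rcq P W)).trace.re + 2 * δ := by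
  rw [Scq_eq_Rcq]
  have hWs : ∀ x, IsState (W x) := fun x => ⟨(hW x).posSemidef, (hW x).2.2⟩
  have hσ : IsState (WPavg P W) := WPavg_isState hWs hP0 hP1
  set σ := WPavg P W with hσdef
  set E : Matrix (X × n) (X × n) ℂ :=
    Matrix.diagonal (fun p : X × n => (Real.sqrt (P p.1) : ℂ)) with hEdef
  have hE : Eᴴ = E := by
    rw [hEdef, Matrix.diagonal_conjTranspose]
    congr 1
    ext p
    simp
  have hEc (p : X → ℝ) (V : X → Matrix n n ℂ) : Commute E (Rcq p V) :=
    commute_diagonal_Rcq fun x => (Real.sqrt (P x) : ℂ)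
  have hR : Rcq P W = E * E * Rcq (fun _ => 1) W := Rcq_eq_mul hP0
  have hS : Rcq P (fun _ => σ) = E * E * Rcq (fun _ => 1) (fun _ => σ) := Rcq_eq_mul hP0
  have hA : (c • Rcq P (fun _ => σ) - Rcq P W).IsHermitian := by
    have h1 : (Rcq P (fun _ => σ)).IsHermitian := Rcq_isHermitian fun _ => hσ.1.1
    have h2 : (Rcq P W).IsHermitian := Rcq_isHermitian fun x => (hW x).1
    exact Matrix.IsHermitian.sub
      (by simp [Matrix.IsHermitian, Matrix.conjTranspose_smul, h1.eq]) h2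
  have hBH : (σ - t • (1 : Matrix n n ℂ)).IsHermitian :=
    hσ.1.1.sub (by simp [Matrix.IsHermitian, Matrix.conjTranspose_smul])
  have hsQ : ((1 : Matrix X X ℂ) ⊗ₖ
      (σ - t • projNonneg (σ - t • (1 : Matrix n n ℂ)))).PosSemidef :=
    Matrix.PosSemidef.one.kronecker (posSemidef_sub_smul_projNonneg hσ.1)
  have hQH := (projNonneg_posSemidef hBH).1.eq
  have hQQ := projNonneg_mul_self hBH
  generalize projNonneg (σ - t • (1 : Matrix n n ℂ)) = Q at *
  have hTH := (projNonneg_posSemidef hA).1.eq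
  have hTT := projNonneg_mul_self hA
  have hTpos := mul_projNonneg_sub_posSemidef hA
  have hET : Commute E (projNonneg (c • Rcq P (fun _ => σ) - Rcq P W)) :=
    Commute.projNonneg_right hA (Commute.sub_right (Commute.smul_right (hEc _ _) c) (hEc _ _))
  generalize projNonneg (c • Rcq P (fun _ => σ) - Rcq P W) = T at *
  have hcomp : ((1 - T) * (E * (Rcq (fun _ => 1) W - c • Rcq (fun _ => 1) (fun _ => σ)) * E)
      * (1 - T)).PosSemidef := by
    have h := hTpos.conjTranspose_mul_mul_same (1 - T)
    rw [Matrix.conjTranspose_sub, Matrix.conjTranspose_one, hTH] at h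
    have e : E * (Rcq (fun _ => 1) W - c • Rcq (fun _ => 1) (fun _ => σ)) * E
        = -(c • Rcq P (fun _ => σ) - Rcq P W) := by
      rw [mul_assoc, ← ((hEc _ W).sub_right ((hEc _ _).smul_right c)).eq, ← mul_assoc, hS, hR,
        mul_sub, mul_smul_comm, neg_sub]
    rw [e]
    convert h using 1
    generalize c • Rcq P (fun _ => σ) - Rcq P W = B
    calc (1 - T) * -B * (1 - T) = (1 - T) * (B * T - B) * 1 := by noncomm_ring
      _ = (1 - T) * (B * T - B) * (1 - T) + (1 - T) * (B * (T * T) - B * T) := by noncomm_ring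
      _ = _ := by rw [hTT]; simp
  have main := re_trace_projection_le_of_compression hδ hδ1 hc hct hE
    (Rcq_isHermitian fun x => (hW x).1) (Rcq_one_mul_self fun x => (hW x).2.1)
    (N := 1 - T) (Q := (1 : Matrix X X ℂ) ⊗ₖ Q) (s := Rcq (fun _ => 1) (fun _ => σ))
    (by rw [Matrix.conjTranspose_sub, Matrix.conjTranspose_one, hTH])
    (by rw [mul_sub, sub_mul, sub_mul, hTT]; simp)
    (by rw [Matrix.conjTranspose_kronecker, Matrix.conjTranspose_one, hQH])
    (by rw [← Matrix.mul_kronecker_mul, hQQ, mul_one])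
    (hEc _ _) ((Commute.one_right E).sub_right hET)
    (by rw [← hR, trace_Rcq, ← hσdef, hσ.2, Complex.one_re])
    (by
      convert hsQ using 1
      rw [Rcq_one_const]
      ext p q
      simp only [Matrix.sub_apply, Matrix.smul_apply, Matrix.kroneckerMap_apply, mul_sub,
        mul_smul_comm])
    hcomp
  rw [← hR, trace_Rcq_mul_one_kronecker, mul_sub, Matrix.trace_sub, mul_one, trace_Rcq, ← hσdef,
    hσ.2, Complex.sub_re, Complex.one_re] at main
  linarith

end InformationSpectrum

/-- for a pure-state cq-channel and a distribution `P`,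
`D_s^ε(R[P] ‖ S[P, W_P]) ≤ H_s^{ε+2δ}(W_P) + 2 log(1/δ)`. -/
theorem statement_1 {X : Type} [Fintype X] [DecidableEq X] {d : ℕ}
    (W : X → Matrix (Fin d) (Fin d) ℂ) (hW : ∀ x, IsPureState (W x))
    (P : X → ℝ) (hP0 : ∀ x, 0 ≤ P x) (hP1 : ∑ x, P x = 1)
    (ε δ : ℝ) (hε : ε ∈ Set.Ioo (0 : ℝ) 1) (hδ : δ ∈ Set.Ioo (0 : ℝ) 1)
    (hsum : ε + 2 * δ < 1) :
    Ds ε (Rcq P W) (Scq P (WPavg P W))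
      ≤ Hs (ε + 2 * δ) (WPavg P W) + 2 * Real.log (1 / δ) := by
  have hWs : ∀ x, IsState (W x) := fun x => ⟨(hW x).posSemidef, (hW x).2.2⟩
  have hσ : IsState (WPavg P W) := WPavg_isState hWs hP0 hP1
  refine csSup_le ⟨_, log_mem_Ds_set (Rcq_isHermitian fun x => (hW x).1)
    (Rcq_isState (fun _ => hσ) hP0 hP1) hε.1⟩ fun lam hlam => ?_
  rw [Set.mem_ofPred_eq] at hlam
  rw [← sub_le_iff_le_add]
  refine le_csSup (Hs_bddAbove hσ hsum) ?_
  rw [Set.mem_ofPred_eq]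
  have hct : Real.exp lam * Real.exp (-(lam - 2 * Real.log (1 / δ))) * δ ^ 2 = 1 := by
    have hδ2 : δ ^ 2 = Real.exp (2 * Real.log δ) := by
      rw [two_mul, Real.exp_add, Real.exp_log hδ.1, sq]
    rw [hδ2, ← Real.exp_add, ← Real.exp_add, one_div, Real.log_inv, Real.exp_eq_one_iff]
    ring
  have := re_trace_WPavg_mul_projNonneg_le hW hP0 hP1 hδ.1 hδ.2.le (Real.exp_pos lam) hct
  linarith
end

section
/- Let G be a finite group, f: G → U(d) a unitary representation, and ρ a state on ℂ^d; set av_f[ρ] := |G|^{−1} Σ_{g∈G} f(g)ρf(g)†. Let Γ(X) := Σ_i K_i X K_i† be a trace-preserving completely positive map on d×d matrices given by finitely many Kraus operators K_i with Σ_i K_i†K_i = I, and suppose Γ is covariant, i.e., Γ(f(g)Xf(g)†) = f(g)Γ(X)f(g)† for all g ∈ G and all d×d matrices X. Then the amount of asymmetry does not increase: S(av_f[Γ(ρ)]) − S(Γ(ρ)) ≤ S(av_f[ρ]) − S(ρ). -/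
open scoped ComplexOrder

/-- Matrix logarithm of a Hermitian matrix, computed via the spectral
decomposition with the convention `log 0 := 0` (junk value `0` if the matrix
is not Hermitian). -/
noncomputable def matLog {n : Type*} [Fintype n] [DecidableEq n]
    (A : Matrix n n ℂ) : Matrix n n ℂ :=
  if hA : A.IsHermitian then
    (hA.eigenvectorUnitary : Matrix n n ℂ) *
      Matrix.diagonal (fun i =>
        if hA.eigenvalues i = 0 then (0 : ℂ) else (Real.log (hA.eigenvalues i) : ℂ)) *
      star (hA.eigenvectorUnitary : Matrix n n ℂ)
  else 0

/-- The von Neumann entropy `S(ρ) = −tr(ρ log ρ)` (with `0 log 0 := 0`). -/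
noncomputable def vN {n : Type*} [Fintype n] [DecidableEq n]
    (ρ : Matrix n n ℂ) : ℝ :=
  - ((ρ * matLog ρ).trace).re

/-- The quantum relative entropy `D(ρ‖σ) = tr ρ (log ρ − log σ)`. -/
noncomputable def Drel {n : Type*} [Fintype n] [DecidableEq n]
    (ρ σ : Matrix n n ℂ) : ℝ :=
  ((ρ * (matLog ρ - matLog σ)).trace).re

/-- The group-averaged state `av_f[ρ] = |G|⁻¹ Σ_g f(g) ρ f(g)†`. -/
noncomputable def avf {G : Type*} [Group G] [Fintype G] {n : Type*}
    [Fintype n] [DecidableEq n]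
    (f : G →* Matrix.unitaryGroup n ℂ) (ρ : Matrix n n ℂ) : Matrix n n ℂ :=
  ((Fintype.card G : ℂ)⁻¹) •
    ∑ g, (f g : Matrix n n ℂ) * ρ * star (f g : Matrix n n ℂ)

open Matrix Filter Topology

section Kraus

variable {ι n : Type*} [Fintype ι] [Fintype n]

/-- The completely positive map with Kraus operators `K`. -/
def krausMap (K : ι → Matrix n n ℂ) (A : Matrix n n ℂ) : Matrix n n ℂ :=
  ∑ i, K i * A * star (K i)

theorem krausMap_sub_smul (K : ι → Matrix n n ℂ) (A B : Matrix n n ℂ) (c : ℂ) :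
    krausMap K (B - c • A) = krausMap K B - c • krausMap K A := by
  simp only [krausMap, mul_sub, sub_mul, mul_smul_comm, smul_mul_assoc, Finset.sum_sub_distrib,
    Finset.smul_sum]

theorem star_krausMap (K : ι → Matrix n n ℂ) (A : Matrix n n ℂ) :
    star (krausMap K A) = krausMap K (star A) := by
  simp only [krausMap, star_sum, star_mul, star_star, mul_assoc]

theorem Matrix.PosSemidef.krausMap {A : Matrix n n ℂ} (hA : A.PosSemidef)
    (K : ι → Matrix n n ℂ) : (krausMap K A).PosSemidef :=
  posSemidef_sum _ fun i _ => hA.mul_mul_conjTranspose_same (K i)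

theorem trace_krausMap_mul (K : ι → Matrix n n ℂ) (A X : Matrix n n ℂ) :
    (krausMap K A * X).trace = (A * krausMap (fun i => star (K i)) X).trace := by
  simp only [krausMap, Finset.sum_mul, Finset.mul_sum, trace_sum, star_star]
  refine Finset.sum_congr rfl fun i _ => ?_
  rw [mul_assoc, mul_assoc, trace_mul_comm]
  simp only [mul_assoc]

end Kraus

section RelativeEntropy

variable {n : Type*} [Fintype n] [DecidableEq n]

/-- `overlap hA hB i j` is the squared modulus of the inner product of the `i`-th eigenvector of
`A` and the `j`-th eigenvector of `B`. -/
noncomputable def overlap {A B : Matrix n n ℂ} (hA : A.IsHermitian) (hB : B.IsHermitian)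
    (i j : n) : ℝ :=
  Complex.normSq ((star (hA.eigenvectorUnitary : Matrix n n ℂ) *
    (hB.eigenvectorUnitary : Matrix n n ℂ)) i j)

theorem overlap_nonneg {A B : Matrix n n ℂ} (hA : A.IsHermitian) (hB : B.IsHermitian)
    (i j : n) : 0 ≤ overlap hA hB i j :=
  Complex.normSq_nonneg _

theorem Matrix.IsHermitian.eigenvectorUnitary_mul_star {A : Matrix n n ℂ} (hA : A.IsHermitian) :
    (hA.eigenvectorUnitary : Matrix n n ℂ) * star (hA.eigenvectorUnitary : Matrix n n ℂ) = 1 :=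
  Unitary.coe_mul_star_self _

theorem Matrix.IsHermitian.star_eigenvectorUnitary_mul {A : Matrix n n ℂ} (hA : A.IsHermitian) :
    star (hA.eigenvectorUnitary : Matrix n n ℂ) * (hA.eigenvectorUnitary : Matrix n n ℂ) = 1 :=
  Unitary.coe_star_mul_self _

theorem overlap_self {A : Matrix n n ℂ} (hA : A.IsHermitian) (i j : n) :
    overlap hA hA i j = if i = j then 1 else 0 := by
  rw [overlap, hA.star_eigenvectorUnitary_mul, one_apply]
  split_ifs <;> simp

theorem sum_overlap {A B : Matrix n n ℂ} (hA : A.IsHermitian) (hB : B.IsHermitian) (i : n) :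
    ∑ j, overlap hA hB i j = 1 := by
  have h : (star (hA.eigenvectorUnitary : Matrix n n ℂ) * (hB.eigenvectorUnitary : Matrix n n ℂ)) *
      star (star (hA.eigenvectorUnitary : Matrix n n ℂ) *
        (hB.eigenvectorUnitary : Matrix n n ℂ)) = 1 := by
    rw [star_mul, star_star, mul_assoc, ← mul_assoc (hB.eigenvectorUnitary : Matrix n n ℂ),
      hB.eigenvectorUnitary_mul_star, one_mul, hA.star_eigenvectorUnitary_mul]
  have h' := congrArg Complex.re (congrFun (congrFun h i) i)
  rw [mul_apply, one_apply_eq, Complex.one_re, Complex.re_sum] at h'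
  rw [← h']
  refine Finset.sum_congr rfl fun j _ => ?_
  rw [star_apply, RCLike.star_def, Complex.mul_conj, Complex.ofReal_re, overlap]

theorem Matrix.IsHermitian.eq_mul_diagonal_mul_star {A : Matrix n n ℂ} (hA : A.IsHermitian) :
    A = (hA.eigenvectorUnitary : Matrix n n ℂ) *
      diagonal (fun i => (hA.eigenvalues i : ℂ)) *
      star (hA.eigenvectorUnitary : Matrix n n ℂ) := by
  conv_lhs => rw [hA.spectral_theorem, Unitary.conjStarAlgAut_apply]
  rfl

theorem Matrix.IsHermitian.matLog_eq {A : Matrix n n ℂ} (hA : A.IsHermitian) :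
    matLog A = (hA.eigenvectorUnitary : Matrix n n ℂ) *
      diagonal (fun i => (Real.log (hA.eigenvalues i) : ℂ)) *
      star (hA.eigenvectorUnitary : Matrix n n ℂ) := by
  rw [matLog, dif_pos hA]
  congr 3
  ext i
  split_ifs with h <;> simp [h]

theorem Matrix.IsHermitian.matLog_eq_cfc {A : Matrix n n ℂ} (hA : A.IsHermitian) :
    matLog A = cfc Real.log A := by
  rw [hA.cfc_eq, hA.matLog_eq, Matrix.IsHermitian.cfc, Unitary.conjStarAlgAut_apply]
  rfl

theorem trace_diagonal_mul_mul_diagonal_mul_star (a b : n → ℝ) (M : Matrix n n ℂ) :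
    (diagonal (fun i => (a i : ℂ)) * M * diagonal (fun j => (b j : ℂ)) * star M).trace =
      ((∑ i, ∑ j, a i * b j * Complex.normSq (M i j) : ℝ) : ℂ) := by
  simp only [Matrix.trace, Matrix.diag_apply, Matrix.mul_apply (N := star M), star_apply,
    mul_diagonal, diagonal_mul]
  push_cast
  refine Finset.sum_congr rfl fun i _ => Finset.sum_congr rfl fun j _ => ?_
  rw [← Complex.mul_conj]
  simp only [RCLike.star_def]
  ring

/-- The trace of a product of two matrices in spectral form. -/
theorem trace_spectral_mul_spectral {A B : Matrix n n ℂ} (hA : A.IsHermitian)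
    (hB : B.IsHermitian) (b : n → ℝ) :
    (A * ((hB.eigenvectorUnitary : Matrix n n ℂ) * diagonal (fun i => (b i : ℂ)) *
      star (hB.eigenvectorUnitary : Matrix n n ℂ))).trace =
      ((∑ i, ∑ j, hA.eigenvalues i * b j * overlap hA hB i j : ℝ) : ℂ) := by
  conv_lhs => rw [hA.eq_mul_diagonal_mul_star]
  unfold overlap
  rw [← trace_diagonal_mul_mul_diagonal_mul_star, mul_assoc, mul_assoc, trace_mul_comm]
  simp only [star_mul, star_star, mul_assoc]

theorem re_trace_eq_sum_overlap {A B : Matrix n n ℂ} (hA : A.IsHermitian)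
    (hB : B.IsHermitian) :
    A.trace.re = ∑ i, ∑ j, hA.eigenvalues i * overlap hA hB i j := by
  have h := trace_spectral_mul_spectral hA hB 1
  simp only [Pi.one_apply, Complex.ofReal_one, diagonal_one, mul_one,
    hB.eigenvectorUnitary_mul_star] at h
  rw [h, Complex.ofReal_re]

theorem Drel_eq_sum_overlap {A B : Matrix n n ℂ} (hA : A.IsHermitian) (hB : B.IsHermitian) :
    Drel A B = ∑ i, ∑ j, hA.eigenvalues i *
      (Real.log (hA.eigenvalues i) - Real.log (hB.eigenvalues j)) * overlap hA hB i j := by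
  have hAA : (A * matLog A).trace.re =
      ∑ i, ∑ j, hA.eigenvalues i * Real.log (hA.eigenvalues i) * overlap hA hB i j := by
    rw [hA.matLog_eq, trace_spectral_mul_spectral hA hA, Complex.ofReal_re]
    refine Finset.sum_congr rfl fun i _ => ?_
    rw [← Finset.mul_sum, sum_overlap]
    simp [overlap_self]
  rw [Drel, mul_sub, trace_sub, Complex.sub_re, hAA, hB.matLog_eq,
    trace_spectral_mul_spectral hA hB, Complex.ofReal_re, ← Finset.sum_sub_distrib]
  simp only [← Finset.sum_sub_distrib]
  refine Finset.sum_congr rfl fun i _ => Finset.sum_congr rfl fun j _ => ?_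
  ring

theorem trace_mul_mul_star {A B : Matrix n n ℂ} (hA : A.IsHermitian) (hB : B.IsHermitian)
    (X : Matrix n n ℂ) :
    (A * (X * star X)).trace.re = ∑ i, ∑ j, hA.eigenvalues i * Complex.normSq
      ((star (hA.eigenvectorUnitary : Matrix n n ℂ) * X *
        (hB.eigenvectorUnitary : Matrix n n ℂ)) i j) := by
  have h := trace_diagonal_mul_mul_diagonal_mul_star hA.eigenvalues 1
    (star (hA.eigenvectorUnitary : Matrix n n ℂ) * X * (hB.eigenvectorUnitary : Matrix n n ℂ))
  simp only [Pi.one_apply, Complex.ofReal_one, diagonal_one, mul_one] at h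
  rw [← Complex.ofReal_re (∑ i, _), ← h]
  congr 1
  conv_lhs => rw [hA.eq_mul_diagonal_mul_star]
  rw [mul_assoc, mul_assoc, trace_mul_comm]
  simp only [star_mul, star_star, mul_assoc]
  rw [← mul_assoc (hB.eigenvectorUnitary : Matrix n n ℂ), hB.eigenvectorUnitary_mul_star, one_mul]

theorem trace_mul_star_mul {A B : Matrix n n ℂ} (hA : A.IsHermitian) (hB : B.IsHermitian)
    (Y : Matrix n n ℂ) :
    (B * (star Y * Y)).trace.re = ∑ i, ∑ j, hB.eigenvalues j * Complex.normSq
      ((star (hA.eigenvectorUnitary : Matrix n n ℂ) * Y *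
        (hB.eigenvectorUnitary : Matrix n n ℂ)) i j) := by
  have h := trace_mul_mul_star hB hA (star Y)
  rw [star_star] at h
  rw [h, Finset.sum_comm]
  refine Finset.sum_congr rfl fun i _ => Finset.sum_congr rfl fun j _ => ?_
  rw [← Complex.normSq_conj, ← RCLike.star_def, ← star_apply]
  simp only [star_mul, star_star, mul_assoc]

theorem parallel_sum_le {p q u : ℝ} (hp : 0 ≤ p) (hq : 0 ≤ q) (hu : 0 < u) (c x : ℂ) :
    u * (p * q / (q + u * p) * Complex.normSq c) ≤
      u * (p * Complex.normSq x) + q * Complex.normSq (c - x) := by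
  rcases (add_nonneg hq (mul_nonneg hu.le hp)).eq_or_lt with h | h
  · rw [← h]
    simp only [div_zero, zero_mul, mul_zero]
    have := Complex.normSq_nonneg x
    have := Complex.normSq_nonneg (c - x)
    positivity
  · rw [div_mul_eq_mul_div, mul_div_assoc', div_le_iff₀ h]
    simp only [Complex.normSq_apply, Complex.sub_re, Complex.sub_im]
    nlinarith [sq_nonneg (q * c.re - (q + u * p) * x.re),
      sq_nonneg (q * c.im - (q + u * p) * x.im)]

theorem parallel_sum_eq {p q u : ℝ} (hp : 0 ≤ p) (hq : 0 ≤ q) (hu : 0 < u) (c : ℂ) :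
    u * (p * Complex.normSq ((q / (q + u * p) : ℝ) * c)) +
      q * Complex.normSq (c - (q / (q + u * p) : ℝ) * c) =
      u * (p * q / (q + u * p) * Complex.normSq c) := by
  have e : c - (q / (q + u * p) : ℝ) * c = ((1 - q / (q + u * p) : ℝ) : ℂ) * c := by
    push_cast; ring
  rw [e, Complex.normSq_mul, Complex.normSq_mul, Complex.normSq_ofReal, Complex.normSq_ofReal]
  rcases (add_nonneg hq (mul_nonneg hu.le hp)).eq_or_lt with h | h
  · have hq0 : q = 0 := by nlinarith [mul_nonneg hu.le hp]
    simp [hq0]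
  · field_simp
    ring

/-- The regularised parallel sum of the spectra of `A` and `B`, weighted by the overlaps. -/
noncomputable def parallelSum {A B : Matrix n n ℂ} (hA : A.IsHermitian) (hB : B.IsHermitian)
    (u : ℝ) : ℝ :=
  ∑ i, ∑ j, hA.eigenvalues i * hB.eigenvalues j /
    (hB.eigenvalues j + u * hA.eigenvalues i) * overlap hA hB i j

theorem parallelSum_le {A B : Matrix n n ℂ} (hA : A.PosSemidef) (hB : B.PosSemidef)
    {u : ℝ} (hu : 0 < u) (X : Matrix n n ℂ) :
    u * parallelSum hA.1 hB.1 u ≤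
      u * (A * (X * star X)).trace.re + (B * (star (1 - X) * (1 - X))).trace.re := by
  rw [trace_mul_mul_star hA.1 hB.1, trace_mul_star_mul hA.1 hB.1, parallelSum]
  simp only [Finset.mul_sum, ← Finset.sum_add_distrib]
  refine Finset.sum_le_sum fun i _ => Finset.sum_le_sum fun j _ => ?_
  rw [mul_sub, sub_mul, mul_one, Matrix.sub_apply]
  exact parallel_sum_le (hA.eigenvalues_nonneg i) (hB.eigenvalues_nonneg j) hu _ _

theorem exists_parallelSum_eq {A B : Matrix n n ℂ} (hA : A.PosSemidef) (hB : B.PosSemidef)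
    {u : ℝ} (hu : 0 < u) :
    ∃ X : Matrix n n ℂ,
      u * (A * (X * star X)).trace.re + (B * (star (1 - X) * (1 - X))).trace.re =
        u * parallelSum hA.1 hB.1 u := by
  set U := (hA.1.eigenvectorUnitary : Matrix n n ℂ) with hU
  set V := (hB.1.eigenvectorUnitary : Matrix n n ℂ) with hV
  let x : Matrix n n ℂ := Matrix.of fun i j =>
    ((hB.1.eigenvalues j / (hB.1.eigenvalues j + u * hA.1.eigenvalues i) : ℝ) : ℂ) *
      (star U * V) i j
  have hx : star U * (U * x * star V) * V = x := by
    have h1 : star U * U = 1 := hA.1.star_eigenvectorUnitary_mul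
    have h2 : star V * V = 1 := hB.1.star_eigenvectorUnitary_mul
    simp only [mul_assoc, h2, mul_one]
    rw [← mul_assoc, h1, one_mul]
  refine ⟨U * x * star V, ?_⟩
  rw [trace_mul_mul_star hA.1 hB.1, trace_mul_star_mul hA.1 hB.1, parallelSum]
  simp only [Finset.mul_sum, ← Finset.sum_add_distrib]
  refine Finset.sum_congr rfl fun i _ => Finset.sum_congr rfl fun j _ => ?_
  rw [mul_sub, sub_mul, mul_one, Matrix.sub_apply, ← hU, ← hV, hx]
  exact parallel_sum_eq (hA.eigenvalues_nonneg i) (hB.eigenvalues_nonneg j) hu _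

theorem Matrix.PosSemidef.re_trace_mul_mul_star_nonneg {A : Matrix n n ℂ} (hA : A.PosSemidef)
    (X : Matrix n n ℂ) : 0 ≤ (A * (X * star X)).trace.re := by
  rw [trace_mul_mul_star hA.1 hA.1]
  exact Finset.sum_nonneg fun i _ => Finset.sum_nonneg fun j _ =>
    mul_nonneg (hA.eigenvalues_nonneg i) (Complex.normSq_nonneg _)

/-- If `B` dominates a positive multiple of `A`, then the kernel of `B` is orthogonal to the
support of `A`. -/
theorem eigenvalues_mul_overlap_eq_zero {A B : Matrix n n ℂ} (hA : A.PosSemidef)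
    (hB : B.IsHermitian) {c : ℝ} (hc : 0 < c) (hAB : (B - (c : ℂ) • A).PosSemidef) (i : n) {j : n}
    (hj : hB.eigenvalues j = 0) : hA.1.eigenvalues i * overlap hA.1 hB i j = 0 := by
  set V := (hB.eigenvectorUnitary : Matrix n n ℂ) with hV
  let b : n → ℝ := Pi.single j 1
  have hE : V * diagonal (fun i => (b i : ℂ)) * star V =
      (V * diagonal (fun i => (b i : ℂ))) * star (V * diagonal (fun i => (b i : ℂ))) := by
    have hd : diagonal (fun i => (b i : ℂ)) * star (diagonal (fun i => (b i : ℂ))) =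
        diagonal (fun i => (b i : ℂ)) := by
      rw [star_eq_conjTranspose, diagonal_conjTranspose, diagonal_mul_diagonal]
      congr 1
      ext k
      by_cases hk : k = j <;> simp [b, hk]
    rw [star_mul, mul_assoc V _ (star _ * star V), ← mul_assoc _ (star _) (star V), hd, mul_assoc]
  have h := hAB.re_trace_mul_mul_star_nonneg (V * diagonal (fun i => (b i : ℂ)))
  rw [← hE, sub_mul, trace_sub, smul_mul_assoc, trace_smul, trace_spectral_mul_spectral hB hB,
    trace_spectral_mul_spectral hA.1 hB, smul_eq_mul, ← Complex.ofReal_mul, ← Complex.ofReal_sub,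
    Complex.ofReal_re] at h
  have h1 : ∑ k, ∑ l, hB.eigenvalues k * b l * overlap hB hB k l = 0 := by
    refine Finset.sum_eq_zero fun k _ => Finset.sum_eq_zero fun l _ => ?_
    rw [overlap_self]
    rcases eq_or_ne k l with rfl | hkl
    · rcases eq_or_ne k j with rfl | hkj
      · simp [hj]
      · simp [b, hkj]
    · simp [hkl]
  have h2 : ∑ k, ∑ l, hA.1.eigenvalues k * b l * overlap hA.1 hB k l =
      ∑ k, hA.1.eigenvalues k * overlap hA.1 hB k j := by
    refine Finset.sum_congr rfl fun k _ => ?_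
    rw [Finset.sum_eq_single j]
    · simp [b]
    · intro l _ hl
      simp [b, hl]
    · simp
  rw [h1, h2, zero_sub] at h
  have hnn : ∀ k ∈ Finset.univ, 0 ≤ hA.1.eigenvalues k * overlap hA.1 hB k j := fun k _ =>
    mul_nonneg (hA.eigenvalues_nonneg k) (overlap_nonneg _ _ _ _)
  have h0 : ∑ k, hA.1.eigenvalues k * overlap hA.1 hB k j = 0 :=
    le_antisymm (by nlinarith) (Finset.sum_nonneg hnn)
  exact (Finset.sum_eq_zero_iff_of_nonneg hnn).1 h0 i (Finset.mem_univ i)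

section KadisonSchwarz

variable {ι : Type*} [Fintype ι]

/-- The Kadison–Schwarz inequality for the adjoint of a trace-preserving completely positive
map, tested against a positive semidefinite matrix. -/
theorem kadison_schwarz {K : ι → Matrix n n ℂ} (hK : ∑ i, star (K i) * K i = 1)
    {A : Matrix n n ℂ} (hA : A.PosSemidef) (X : Matrix n n ℂ) :
    (A * (krausMap (fun i => star (K i)) X * star (krausMap (fun i => star (K i)) X))).trace.re ≤
      (krausMap K A * (X * star X)).trace.re := by
  rw [trace_krausMap_mul]
  set Z := krausMap (fun i => star (K i)) X with hZ
  have key : krausMap (fun i => star (K i)) (X * star X) = Z * star Z +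
      ∑ i, (star (K i) * X - Z * star (K i)) * star (star (K i) * X - Z * star (K i)) := by
    have e : ∀ i, (star (K i) * X - Z * star (K i)) * star (star (K i) * X - Z * star (K i)) =
        star (K i) * (X * star X) * star (star (K i)) -
          (star (K i) * X * star (star (K i))) * star Z -
          Z * star (star (K i) * X * star (star (K i))) + Z * (star (K i) * K i) * star Z := by
      intro i
      simp only [star_sub, star_mul, star_star]
      noncomm_ring
    simp only [e, Finset.sum_add_distrib, Finset.sum_sub_distrib]
    rw [← Finset.sum_mul, ← Finset.mul_sum, ← Finset.sum_mul, ← Finset.mul_sum, ← star_sum, hK]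
    change _ = Z * star Z + (krausMap (fun i => star (K i)) (X * star X) - Z * star Z -
      Z * star Z + Z * 1 * star Z)
    rw [mul_one]
    abel
  rw [key, mul_add, trace_add, Complex.add_re, Finset.mul_sum, trace_sum, Complex.re_sum]
  exact le_add_of_nonneg_right <| Finset.sum_nonneg fun i _ => hA.re_trace_mul_mul_star_nonneg _

theorem parallelSum_le_parallelSum_krausMap {K : ι → Matrix n n ℂ}
    (hK : ∑ i, star (K i) * K i = 1) {A B : Matrix n n ℂ} (hA : A.PosSemidef)
    (hB : B.PosSemidef) {u : ℝ} (hu : 0 < u) :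
    parallelSum hA.1 hB.1 u ≤ parallelSum (hA.krausMap K).1 (hB.krausMap K).1 u := by
  obtain ⟨X, hX⟩ := exists_parallelSum_eq (hA.krausMap K) (hB.krausMap K) hu
  refine le_of_mul_le_mul_left ?_ hu
  rw [← hX]
  refine (parallelSum_le hA hB hu (krausMap (fun i => star (K i)) X)).trans ?_
  have h1 := kadison_schwarz hK hA X
  have h2 := kadison_schwarz hK hB (star (1 - X))
  have e : krausMap (fun i => star (K i)) (1 - X) = 1 - krausMap (fun i => star (K i)) X := by
    have := krausMap_sub_smul (fun i => star (K i)) X 1 1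
    rw [one_smul, one_smul] at this
    rw [this]
    congr 1
    simpa [krausMap] using hK
  rw [← star_krausMap, star_star, star_star, e] at h2
  gcongr

end KadisonSchwarz

/-- A path whose value at `0` vanishes and which tends to the relative entropy at infinity. -/
noncomputable def entropyPath {A B : Matrix n n ℂ} (hA : A.IsHermitian) (hB : B.IsHermitian)
    (u : ℝ) : ℝ :=
  ∑ i, ∑ j, hA.eigenvalues i * overlap hA hB i j *
    (Real.log (hB.eigenvalues j + u * hA.eigenvalues i) - Real.log (1 + u) -
      Real.log (hB.eigenvalues j))

theorem entropyPath_zero {A B : Matrix n n ℂ} (hA : A.IsHermitian) (hB : B.IsHermitian) :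
    entropyPath hA hB 0 = 0 := by
  simp [entropyPath]

theorem continuousOn_entropyPath {A B : Matrix n n ℂ} (hA : A.PosSemidef) (hB : B.PosSemidef)
    (hs : ∀ i j, hB.1.eigenvalues j = 0 → hA.1.eigenvalues i * overlap hA.1 hB.1 i j = 0) :
    ContinuousOn (entropyPath hA.1 hB.1) (Set.Ici 0) := by
  unfold entropyPath
  refine continuousOn_finsetSum _ fun i _ => continuousOn_finsetSum _ fun j _ => ?_
  rcases (hB.eigenvalues_nonneg j).eq_or_lt with hq | hq
  · simp only [hs i j hq.symm, zero_mul]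
    exact continuousOn_const
  · have hp := hA.eigenvalues_nonneg i
    intro u hu
    have hu : 0 ≤ u := hu
    have h1 : hB.1.eigenvalues j + u * hA.1.eigenvalues i ≠ 0 := by positivity
    have h2 : 1 + u ≠ 0 := by positivity
    exact ContinuousAt.continuousWithinAt (by fun_prop (disch := assumption))

theorem hasDerivAt_entropyPath {A B : Matrix n n ℂ} (hA : A.PosSemidef) (hB : B.PosSemidef)
    (hs : ∀ i j, hB.1.eigenvalues j = 0 → hA.1.eigenvalues i * overlap hA.1 hB.1 i j = 0)
    {u : ℝ} (hu : 0 < u) :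
    HasDerivAt (entropyPath hA.1 hB.1)
      (A.trace.re * (1 / u - 1 / (1 + u)) - parallelSum hA.1 hB.1 u / u) u := by
  rw [re_trace_eq_sum_overlap hA.1 hB.1, parallelSum]
  simp only [Finset.sum_mul, Finset.sum_div, ← Finset.sum_sub_distrib]
  unfold entropyPath
  refine HasDerivAt.fun_sum fun i _ => HasDerivAt.fun_sum fun j _ => ?_
  rw [show hA.1.eigenvalues i * overlap hA.1 hB.1 i j * (1 / u - 1 / (1 + u)) -
      hA.1.eigenvalues i * hB.1.eigenvalues j / (hB.1.eigenvalues j + u * hA.1.eigenvalues i) *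
        overlap hA.1 hB.1 i j / u = hA.1.eigenvalues i * overlap hA.1 hB.1 i j *
      (1 / u - 1 / (1 + u) -
        hB.1.eigenvalues j / (hB.1.eigenvalues j + u * hA.1.eigenvalues i) / u) by ring]
  rcases (hB.eigenvalues_nonneg j).eq_or_lt with hq | hq
  · simp only [hs i j hq.symm, zero_mul]
    exact hasDerivAt_const _ _
  · have hp := hA.eigenvalues_nonneg i
    have h1 : hB.1.eigenvalues j + u * hA.1.eigenvalues i ≠ 0 := by positivity
    have h2 : 1 + u ≠ 0 := by positivity
    have d1 := (((hasDerivAt_id u).mul_const (hA.1.eigenvalues i)).const_add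
      (hB.1.eigenvalues j)).log h1
    have d2 := ((hasDerivAt_id u).const_add 1).log h2
    refine (((d1.sub d2).sub_const (Real.log (hB.1.eigenvalues j))).const_mul
      (hA.1.eigenvalues i * overlap hA.1 hB.1 i j)).congr_deriv ?_
    congr 1
    simp only [id]
    field_simp
    ring

theorem tendsto_entropyPath {A B : Matrix n n ℂ} (hA : A.PosSemidef) (hB : B.PosSemidef)
    (hs : ∀ i j, hB.1.eigenvalues j = 0 → hA.1.eigenvalues i * overlap hA.1 hB.1 i j = 0) :
    Tendsto (entropyPath hA.1 hB.1) atTop (𝓝 (Drel A B)) := by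
  rw [Drel_eq_sum_overlap hA.1 hB.1]
  unfold entropyPath
  refine tendsto_finsetSum _ fun i _ => tendsto_finsetSum _ fun j _ => ?_
  rw [mul_right_comm]
  rcases (hB.eigenvalues_nonneg j).eq_or_lt with hq | hq
  · simp only [hs i j hq.symm, zero_mul]
    exact tendsto_const_nhds
  rcases (hA.eigenvalues_nonneg i).eq_or_lt with hp | hp
  · simp only [← hp, zero_mul]
    exact tendsto_const_nhds
  refine Tendsto.const_mul _ (Tendsto.sub_const ?_ _)
  set p := hA.1.eigenvalues i
  set q := hB.1.eigenvalues j
  have h1 : Tendsto (fun u : ℝ => p + (q - p) / (1 + u)) atTop (𝓝 (p + 0)) :=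
    tendsto_const_nhds.add (tendsto_const_nhds.div_atTop
      (tendsto_atTop_add_const_left _ _ tendsto_id))
  rw [add_zero] at h1
  refine (h1.log hp.ne').congr' ?_
  filter_upwards [eventually_ge_atTop 0] with u hu
  rw [← Real.log_div (by positivity) (by positivity)]
  congr 1
  field_simp
  ring

/-- Monotonicity of the relative entropy under trace-preserving completely positive maps. -/
theorem Drel_krausMap_le {ι : Type*} [Fintype ι] {K : ι → Matrix n n ℂ}
    (hK : ∑ i, star (K i) * K i = 1) {A B : Matrix n n ℂ} (hA : A.PosSemidef)
    (hB : B.PosSemidef) {c : ℝ} (hc : 0 < c) (hAB : (B - (c : ℂ) • A).PosSemidef) :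
    Drel (krausMap K A) (krausMap K B) ≤ Drel A B := by
  have hA' := hA.krausMap K
  have hB' := hB.krausMap K
  have hs := fun i j => eigenvalues_mul_overlap_eq_zero hA hB.1 hc hAB i (j := j)
  have hAB' : (krausMap K B - (c : ℂ) • krausMap K A).PosSemidef := by
    rw [← krausMap_sub_smul]
    exact hAB.krausMap K
  have hs' := fun i j => eigenvalues_mul_overlap_eq_zero hA' hB'.1 hc hAB' i (j := j)
  have htr : (krausMap K A).trace = A.trace := by
    have h := trace_krausMap_mul K A 1
    simpa [krausMap, hK] using h
  have hder : ∀ u : ℝ, 0 < u → HasDerivAt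
      (fun u => entropyPath hA'.1 hB'.1 u - entropyPath hA.1 hB.1 u)
      (-((parallelSum hA'.1 hB'.1 u - parallelSum hA.1 hB.1 u) / u)) u := fun u hu =>
    ((hasDerivAt_entropyPath hA' hB' hs' hu).sub
      (hasDerivAt_entropyPath hA hB hs hu)).congr_deriv (by rw [htr]; ring)
  have hanti : AntitoneOn (fun u => entropyPath hA'.1 hB'.1 u - entropyPath hA.1 hB.1 u)
      (Set.Ici 0) := by
    refine antitoneOn_of_deriv_nonpos (convex_Ici 0)
      ((continuousOn_entropyPath hA' hB' hs').sub (continuousOn_entropyPath hA hB hs)) ?_ ?_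
    · intro u hu
      rw [interior_Ici] at hu
      exact (hder u hu).differentiableAt.differentiableWithinAt
    · intro u hu
      rw [interior_Ici] at hu
      rw [(hder u hu).deriv, neg_nonpos]
      exact div_nonneg (sub_nonneg.2 (parallelSum_le_parallelSum_krausMap hK hA hB hu)) (le_of_lt hu)
  refine sub_nonpos.1 (le_of_tendsto ((tendsto_entropyPath hA' hB' hs').sub
    (tendsto_entropyPath hA hB hs)) ?_)
  filter_upwards [eventually_ge_atTop 0] with u hu
  have h := hanti (Set.mem_Ici.2 le_rfl) (Set.mem_Ici.2 hu) hu
  simpa [entropyPath_zero] using h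

end RelativeEntropy

section Twirl

variable {G : Type*} [Group G] [Fintype G] {n : Type*} [Fintype n] [DecidableEq n]
  (f : G →* Matrix.unitaryGroup n ℂ)

theorem conj_avf (ρ : Matrix n n ℂ) (h : G) :
    (f h : Matrix n n ℂ) * avf f ρ * star (f h : Matrix n n ℂ) = avf f ρ := by
  simp only [avf, mul_smul_comm, smul_mul_assoc, Finset.mul_sum, Finset.sum_mul]
  congr 1
  refine Fintype.sum_equiv (Equiv.mulLeft h) _ _ fun g => ?_
  simp only [Equiv.coe_mulLeft, map_mul, Submonoid.coe_mul, star_mul, mul_assoc]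

theorem commute_avf (ρ : Matrix n n ℂ) (h : G) : Commute (avf f ρ) (f h : Matrix n n ℂ) := by
  have e := congrArg (· * (f h : Matrix n n ℂ)) (conj_avf f ρ h)
  have hu : star (f h : Matrix n n ℂ) * (f h : Matrix n n ℂ) = 1 := Unitary.coe_star_mul_self _
  simp only [mul_assoc, hu, mul_one] at e
  exact e.symm

theorem trace_avf_mul {L : Matrix n n ℂ} (hL : ∀ g, Commute L (f g : Matrix n n ℂ))
    (ρ : Matrix n n ℂ) : (avf f ρ * L).trace = (ρ * L).trace := by
  have e : ∀ g, ((f g : Matrix n n ℂ) * ρ * star (f g : Matrix n n ℂ) * L).trace =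
      (ρ * L).trace := by
    intro g
    have hu : star (f g : Matrix n n ℂ) * (f g : Matrix n n ℂ) = 1 := Unitary.coe_star_mul_self _
    rw [mul_assoc, mul_assoc, trace_mul_comm, mul_assoc, mul_assoc, (hL g).eq, ← mul_assoc (star _),
      hu, one_mul]
  rw [avf, smul_mul_assoc, Finset.sum_mul, trace_smul, trace_sum]
  simp [e]

theorem Matrix.PosSemidef.avf {ρ : Matrix n n ℂ} (hρ : ρ.PosSemidef) : (avf f ρ).PosSemidef := by
  refine PosSemidef.smul (posSemidef_sum _ fun g _ => ?_) ?_
  · exact hρ.mul_mul_conjTranspose_same _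
  · exact inv_nonneg.2 (Nat.cast_nonneg _)

theorem posSemidef_avf_sub {ρ : Matrix n n ℂ} (hρ : ρ.PosSemidef) :
    (avf f ρ - (((Fintype.card G : ℝ)⁻¹ : ℝ) : ℂ) • ρ).PosSemidef := by
  classical
  rw [_root_.avf, ← Finset.add_sum_erase _ _ (Finset.mem_univ (1 : G))]
  simp only [map_one, OneMemClass.coe_one, one_mul, star_one, mul_one, smul_add, Complex.ofReal_inv,
    Complex.ofReal_natCast, add_sub_cancel_left]
  refine PosSemidef.smul (posSemidef_sum _ fun g _ => ?_) ?_
  · exact hρ.mul_mul_conjTranspose_same _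
  · exact inv_nonneg.2 (Nat.cast_nonneg _)

theorem Drel_avf {ρ : Matrix n n ℂ} (hρ : ρ.PosSemidef) :
    Drel ρ (avf f ρ) = vN (avf f ρ) - vN ρ := by
  have hL : ∀ g, Commute (matLog (avf f ρ)) (f g : Matrix n n ℂ) := fun g => by
    rw [(hρ.avf f).1.matLog_eq_cfc]
    exact (commute_avf f ρ g).cfc_real _
  rw [Drel, vN, vN, trace_avf_mul f hL, mul_sub, trace_sub, Complex.sub_re]
  ring

end Twirl

/-- a covariant trace-preserving completely positive map (given by
finitely many Kraus operators) does not increase the amount of asymmetry: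
`S(av_f[Γ(ρ)]) − S(Γ(ρ)) ≤ S(av_f[ρ]) − S(ρ)`. -/
theorem statement_5 {G : Type} [Group G] [Fintype G] {d : ℕ}
    (f : G →* Matrix.unitaryGroup (Fin d) ℂ)
    (ρ : Matrix (Fin d) (Fin d) ℂ) (hρ : IsState ρ)
    (r : ℕ) (K : Fin r → Matrix (Fin d) (Fin d) ℂ)
    (Γ : Matrix (Fin d) (Fin d) ℂ → Matrix (Fin d) (Fin d) ℂ)
    (hΓ : ∀ A, Γ A = ∑ i, K i * A * star (K i))
    (hTP : ∑ i, star (K i) * K i = 1)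
    (hcov : ∀ (g : G) (A : Matrix (Fin d) (Fin d) ℂ),
      Γ ((f g : Matrix (Fin d) (Fin d) ℂ) * A *
          star (f g : Matrix (Fin d) (Fin d) ℂ))
        = (f g : Matrix (Fin d) (Fin d) ℂ) * Γ A *
          star (f g : Matrix (Fin d) (Fin d) ℂ)) :
    vN (avf f (Γ ρ)) - vN (Γ ρ) ≤ vN (avf f ρ) - vN ρ := by
  have hΓK : ∀ A, Γ A = krausMap K A := hΓ
  have hav : krausMap K (avf f ρ) = avf f (krausMap K ρ) := by
    have hcov' := fun g A => (hcov g A).symm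
    simp only [hΓK] at hcov'
    simp only [avf, hcov', Finset.smul_sum]
    simp only [krausMap, Finset.mul_sum, Finset.sum_mul, mul_smul_comm, smul_mul_assoc,
      Finset.smul_sum]
    exact Finset.sum_comm
  rw [hΓK, ← Drel_avf f hρ.1, ← Drel_avf f (hρ.1.krausMap K), ← hav]
  exact Drel_krausMap_le hTP hρ.1 (hρ.1.avf f)
    (inv_pos.2 (Nat.cast_pos.2 Fintype.card_pos)) (posSemidef_avf_sub f hρ.1)
end

section
/- Fix ξ ∈ (0,1) and integers k ≥ l ≥ 0, and let (m_n) be a sequence of natural numbers with m_n/n → ξ as n → ∞ (so that in particular l ≤ m_n and m_n − l ≤ n − k for all large n). Then log C(n, m_n) − log C(n−k, m_n−l) → k·h(ξ) − log((1−ξ)/ξ)·(ξk − l) as n → ∞. -/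
/-- The binary entropy `h(t) = −t log t − (1−t) log(1−t)` (natural logarithm,
with the convention `0 · log 0 := 0`, which holds since `Real.log 0 = 0`). -/
noncomputable def binH (t : ℝ) : ℝ := -t * Real.log t - (1 - t) * Real.log (1 - t)

open Filter in
theorem tendsto_natCast_sub_div {a b : ℕ → ℕ} {α β : ℝ} (hβα : β < α)
    (ha : Tendsto (fun n : ℕ => (a n : ℝ) / n) atTop (nhds α))
    (hb : Tendsto (fun n : ℕ => (b n : ℝ) / n) atTop (nhds β)) :
    (∀ᶠ n in atTop, b n ≤ a n) ∧
      Tendsto (fun n : ℕ => ((a n - b n : ℕ) : ℝ) / n) atTop (nhds (α - β)) := by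
  have hle : ∀ᶠ n in atTop, b n ≤ a n := by
    filter_upwards [hb.eventually_lt ha hβα, eventually_gt_atTop 0] with n hn hn0
    rw [div_lt_div_iff_of_pos_right (by exact_mod_cast hn0)] at hn
    exact_mod_cast hn.le
  refine ⟨hle, (ha.sub hb).congr' ?_⟩
  filter_upwards [hle] with n hn
  rw [Nat.cast_sub hn, sub_div]

open Filter in
theorem tendsto_descFactorial_div_pow {a : ℕ → ℕ} {α : ℝ} (hα : 0 < α)
    (ha : Tendsto (fun n : ℕ => (a n : ℝ) / n) atTop (nhds α)) (j : ℕ) :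
    Tendsto (fun n : ℕ => ((a n).descFactorial j : ℝ) / (n : ℝ) ^ j) atTop (nhds (α ^ j)) := by
  induction j with
  | zero => simp
  | succ j ih =>
    have h := (tendsto_natCast_sub_div hα ha (tendsto_const_div_atTop_nhds_zero_nat (j : ℝ))).2
    rw [sub_zero] at h
    rw [pow_succ']
    refine (h.mul ih).congr fun n => ?_
    rw [Nat.descFactorial_succ, Nat.cast_mul, pow_succ', mul_div_mul_comm]

theorem choose_mul_descFactorial_mul_descFactorial {n m k l : ℕ} (hlk : l ≤ k) (hlm : l ≤ m)
    (hmn : m ≤ n) (hkl : k - l ≤ n - m) :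
    n.choose m * (m.descFactorial l * (n - m).descFactorial (k - l)) =
      n.descFactorial k * (n - k).choose (m - l) := by
  have h₁ := Nat.choose_mul_factorial_mul_factorial hmn
  have h₂ := Nat.choose_mul_factorial_mul_factorial (show m - l ≤ n - k by omega)
  rw [show n - k - (m - l) = n - m - (k - l) by omega] at h₂
  rw [← Nat.factorial_mul_descFactorial hlm, ← Nat.factorial_mul_descFactorial hkl,
    ← Nat.factorial_mul_descFactorial (show k ≤ n by omega), ← h₂] at h₁
  refine Nat.eq_of_mul_eq_mul_right
    (Nat.mul_pos (m - l).factorial_pos (n - m - (k - l)).factorial_pos) ?_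
  linarith

open Filter in
/-- Type I limit:
`log C(n, m_n) − log C(n−k, m_n−l) → k·h(ξ) − log((1−ξ)/ξ)·(ξk − l)`. -/
theorem statement_7 (ξ : ℝ) (hξ : ξ ∈ Set.Ioo (0 : ℝ) 1) (k l : ℕ) (hlk : l ≤ k)
    (m : ℕ → ℕ)
    (hm : Tendsto (fun n : ℕ => (m n : ℝ) / n) atTop (nhds ξ)) :
    Tendsto (fun n : ℕ =>
        Real.log ((n.choose (m n) : ℝ)) - Real.log (((n - k).choose (m n - l) : ℝ)))
      atTop
      (nhds ((k : ℝ) * binH ξ - Real.log ((1 - ξ) / ξ) * (ξ * k - l))) := by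
  obtain ⟨h0, h1⟩ := hξ
  have h1' : 0 < 1 - ξ := sub_pos.2 h1
  have hid : Tendsto (fun n : ℕ => (n : ℝ) / n) atTop (nhds 1) := by
    refine tendsto_const_nhds.congr' ?_
    filter_upwards [eventually_ne_atTop 0] with n hn
    exact (div_self (Nat.cast_ne_zero.2 hn)).symm
  obtain ⟨hmn, hsub⟩ := tendsto_natCast_sub_div h1 hid hm
  have hlm := (tendsto_natCast_sub_div h0 hm (tendsto_const_div_atTop_nhds_zero_nat (l : ℝ))).1
  have hkl := (tendsto_natCast_sub_div h1' hsub
    (tendsto_const_div_atTop_nhds_zero_nat ((k - l : ℕ) : ℝ))).1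
  have hlim := (tendsto_descFactorial_div_pow one_pos hid k).div
    ((tendsto_descFactorial_div_pow h0 hm l).mul (tendsto_descFactorial_div_pow h1' hsub (k - l)))
    (by positivity)
  have hlog := hlim.log (by positivity)
  have hval : Real.log (1 ^ k / (ξ ^ l * (1 - ξ) ^ (k - l))) =
      (k : ℝ) * binH ξ - Real.log ((1 - ξ) / ξ) * (ξ * k - l) := by
    rw [one_pow, Real.log_div one_ne_zero (by positivity), Real.log_mul (by positivity)
      (by positivity), Real.log_pow, Real.log_pow, Real.log_div h1'.ne' h0.ne', Real.log_one,
      Nat.cast_sub hlk, binH]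
    ring
  rw [hval] at hlog
  refine hlog.congr' ?_
  filter_upwards [hmn, hlm, hkl, eventually_ne_atTop 0] with n hmn hlm hkl hn
  have hn' : (n : ℝ) ≠ 0 := Nat.cast_ne_zero.2 hn
  have hc : (n.choose (m n) : ℝ) ≠ 0 := Nat.cast_ne_zero.2 (Nat.choose_pos hmn).ne'
  have hc' : ((n - k).choose (m n - l) : ℝ) ≠ 0 :=
    Nat.cast_ne_zero.2 (Nat.choose_pos (by omega)).ne'
  have hd : ((m n).descFactorial l : ℝ) ≠ 0 :=
    Nat.cast_ne_zero.2 (Nat.descFactorial_pos.2 hlm).ne'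
  have hd' : ((n - m n).descFactorial (k - l) : ℝ) ≠ 0 :=
    Nat.cast_ne_zero.2 (Nat.descFactorial_pos.2 hkl).ne'
  have key : (n.choose (m n) : ℝ) *
      ((m n).descFactorial l * (n - m n).descFactorial (k - l)) =
      n.descFactorial k * (n - k).choose (m n - l) := by
    exact_mod_cast choose_mul_descFactorial_mul_descFactorial hlk hlm hmn hkl
  rw [← Real.log_div hc hc']
  congr 1
  simp only [Pi.div_apply]
  rw [div_mul_div_comm, ← pow_add, Nat.add_sub_cancel' hlk,
    div_div_div_cancel_right₀ (pow_ne_zero k hn'), div_eq_div_iff (mul_ne_zero hd hd') hc', key]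
end

section
/- Fix reals α, ξ, κ with 0 ≤ α ≤ κ, 0 < ξ < 1, β := ξ − α > 0 and δ := 1 − ξ − κ + α > 0. Let (l_n), (m_n), (k_n) be sequences of natural numbers with l_n/n → α, m_n/n → ξ and k_n/n → κ as n → ∞. Then log C(n, m_n) − log C(n−k_n, m_n−l_n) − [n·h(m_n/n) − (n−k_n)·h((m_n−l_n)/(n−k_n))] converges to (1/2)log(β+δ) − (1/2)log(2πξ(1−ξ)) + (1/2)log(2πβδ/(β+δ)²) as n → ∞. -/
open Filter Real in
/-- If `N n / n` has a positive limit then `N n → ∞`. -/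
theorem tendsto_atTop_of_tendsto_div {N : ℕ → ℕ} {ν : ℝ} (hν : 0 < ν)
    (hN : Tendsto (fun n : ℕ => (N n : ℝ) / n) atTop (nhds ν)) : Tendsto N atTop atTop := by
  rw [← tendsto_natCast_atTop_iff (R := ℝ)]
  refine (hN.pos_mul_atTop hν (tendsto_natCast_atTop_atTop (R := ℝ))).congr' ?_
  filter_upwards [eventually_gt_atTop 0] with n hn
  have : (n : ℝ) ≠ 0 := by positivity
  field_simp

open Filter Real in
/-- The logarithm of a binomial coefficient in terms of the Stirling sequence. -/
theorem log_choose_sub_mul_binH {N M : ℕ} (hM : 0 < M) (hMN : M < N) :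
    log (N.choose M : ℝ) - N * binH ((M : ℝ) / N)
      = log (Stirling.stirlingSeq N) - log (Stirling.stirlingSeq M)
        - log (Stirling.stirlingSeq (N - M))
        + (1 / 2) * (log N - log M - log ((N : ℝ) - M)) - (1 / 2) * log 2 := by
  have hN0 : (0 : ℝ) < N := by exact_mod_cast hM.trans hMN
  have hM0 : (0 : ℝ) < M := by exact_mod_cast hM
  have hD0 : (0 : ℝ) < (N : ℝ) - M := sub_pos.mpr (by exact_mod_cast hMN)
  have hcast : ((N - M : ℕ) : ℝ) = (N : ℝ) - M := Nat.cast_sub hMN.le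
  have hchoose : log (N.choose M : ℝ)
      = log (N.factorial : ℝ) - log (M.factorial : ℝ) - log ((N - M).factorial : ℝ) := by
    rw [Nat.cast_choose ℝ hMN.le, log_div (by positivity) (by positivity),
      log_mul (by positivity) (by positivity)]
    ring
  have hsub : 1 - (M : ℝ) / N = ((N : ℝ) - M) / N := by field_simp
  have hlog : ∀ x : ℝ, 0 < x → log (2 * x) = log 2 + log x ∧ log (x / exp 1) = log x - 1 :=
    fun x hx => ⟨log_mul two_ne_zero hx.ne', by rw [log_div hx.ne' (exp_ne_zero 1), log_exp]⟩
  rw [hchoose, binH, hsub, log_div hM0.ne' hN0.ne', log_div hD0.ne' hN0.ne',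
    Stirling.log_stirlingSeq_formula, Stirling.log_stirlingSeq_formula,
    Stirling.log_stirlingSeq_formula, hcast, (hlog N hN0).1, (hlog N hN0).2,
    (hlog M hM0).1, (hlog M hM0).2, (hlog _ hD0).1, (hlog _ hD0).2]
  field_simp
  ring

open Filter Real in
/-- Second-order asymptotics of `log C(N, M)` when `N` and `M` grow linearly in `n`. -/
theorem tendsto_log_choose_sub_mul_binH {N M : ℕ → ℕ} {ν μ : ℝ} (hμ : 0 < μ) (hμν : μ < ν)
    (hN : Tendsto (fun n : ℕ => (N n : ℝ) / n) atTop (nhds ν))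
    (hM : Tendsto (fun n : ℕ => (M n : ℝ) / n) atTop (nhds μ)) :
    Tendsto (fun n : ℕ => log ((N n).choose (M n) : ℝ) - N n * binH ((M n : ℝ) / N n)
        + (1 / 2) * log n) atTop
      (nhds ((1 / 2) * (log ν - log μ - log (ν - μ)) - (1 / 2) * log (2 * π))) := by
  have hν : 0 < ν := hμ.trans hμν
  have hlt : ∀ᶠ n in atTop, 0 < n ∧ 0 < M n ∧ M n < N n := by
    filter_upwards [eventually_gt_atTop 0, hM.eventually_lt hN hμν,
      hM.eventually_const_lt hμ] with n hn hMN hM0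
    have hn' : (0 : ℝ) < n := by exact_mod_cast hn
    refine ⟨hn, ?_, by exact_mod_cast (div_lt_div_iff_of_pos_right hn').mp hMN⟩
    exact_mod_cast (div_pos_iff_of_pos_right hn').mp hM0
  have hD : Tendsto (fun n : ℕ => ((N n - M n : ℕ) : ℝ) / n) atTop (nhds (ν - μ)) := by
    refine (hN.sub hM).congr' ?_
    filter_upwards [hlt] with n hn
    rw [Nat.cast_sub hn.2.2.le, sub_div]
  have hS {a : ℕ → ℕ} {x : ℝ} (hx : 0 < x)
      (ha : Tendsto (fun n : ℕ => (a n : ℝ) / n) atTop (nhds x)) :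
      Tendsto (fun n => log (Stirling.stirlingSeq (a n))) atTop (nhds (log √π)) :=
    (Stirling.tendsto_stirlingSeq_sqrt_pi.comp (tendsto_atTop_of_tendsto_div hx ha)).log
      (by positivity)
  have hlim : (1 / 2) * (log ν - log μ - log (ν - μ)) - (1 / 2) * log (2 * π)
      = log √π - log √π - log √π + (1 / 2) * (log ν - log μ - log (ν - μ))
        - (1 / 2) * log 2 := by
    rw [log_sqrt pi_pos.le, log_mul two_ne_zero pi_ne_zero]
    ring
  have hμν' : 0 < ν - μ := sub_pos.mpr hμν
  rw [hlim]
  refine (((((hS hν hN).sub (hS hμ hM)).sub (hS hμν' hD)).add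
    ((((hN.log hν.ne').sub (hM.log hμ.ne')).sub (hD.log hμν'.ne')).const_mul (1 / 2))).sub_const
      ((1 / 2) * log 2)).congr' ?_
  filter_upwards [hlt] with n ⟨hn, hM0, hMN⟩
  have hn' : (n : ℝ) ≠ 0 := by positivity
  have hN0 : (N n : ℝ) ≠ 0 := by exact_mod_cast (hM0.trans hMN).ne'
  have hM0' : (M n : ℝ) ≠ 0 := by positivity
  have hD0 : (N n : ℝ) - M n ≠ 0 := (sub_pos.mpr (by exact_mod_cast hMN)).ne'
  rw [log_choose_sub_mul_binH hM0 hMN, Nat.cast_sub hMN.le, log_div hN0 hn', log_div hM0' hn',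
    log_div hD0 hn']
  ring

open Filter Real in
/-- Type II limit of the asymmetry of the decohered state:
`log C(n, m_n) − log C(n−k_n, m_n−l_n) − [n·h(m_n/n) − (n−k_n)·h((m_n−l_n)/(n−k_n))]`
converges to `(1/2)log(β+δ) − (1/2)log(2πξ(1−ξ)) + (1/2)log(2πβδ/(β+δ)²)`. -/
theorem statement_8 (α ξ κ : ℝ) (hα0 : 0 ≤ α) (hακ : α ≤ κ)
    (hξ0 : 0 < ξ) (hξ1 : ξ < 1)
    (β δ : ℝ) (hβdef : β = ξ - α) (hδdef : δ = 1 - ξ - κ + α)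
    (hβ : 0 < β) (hδ : 0 < δ)
    (l m k : ℕ → ℕ)
    (hl : Tendsto (fun n : ℕ => (l n : ℝ) / n) atTop (nhds α))
    (hm : Tendsto (fun n : ℕ => (m n : ℝ) / n) atTop (nhds ξ))
    (hk : Tendsto (fun n : ℕ => (k n : ℝ) / n) atTop (nhds κ)) :
    Tendsto (fun n : ℕ =>
        (Real.log ((n.choose (m n) : ℝ))
          - Real.log (((n - k n).choose (m n - l n) : ℝ)))
        - ((n : ℝ) * binH ((m n : ℝ) / n)
          - ((n : ℝ) - (k n : ℝ)) * binH (((m n : ℝ) - (l n : ℝ)) / ((n : ℝ) - (k n : ℝ)))))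
      atTop
      (nhds ((1 / 2) * Real.log (β + δ) - (1 / 2) * Real.log (2 * π * ξ * (1 - ξ))
        + (1 / 2) * Real.log (2 * π * β * δ / (β + δ) ^ 2))) := by
  have hn1 : Tendsto (fun n : ℕ => (n : ℝ) / n) atTop (nhds 1) :=
    tendsto_const_nhds.congr' (by
      filter_upwards [eventually_gt_atTop 0] with n hn
      rw [div_self (by positivity)])
  have hle {a b : ℕ → ℕ} {x y : ℝ} (hxy : x < y)
      (ha : Tendsto (fun n : ℕ => (a n : ℝ) / n) atTop (nhds x))
      (hb : Tendsto (fun n : ℕ => (b n : ℝ) / n) atTop (nhds y)) :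
      ∀ᶠ n in atTop, a n ≤ b n := by
    filter_upwards [eventually_gt_atTop 0, ha.eventually_lt hb hxy] with n hn h
    have hn' : (0 : ℝ) < n := by exact_mod_cast hn
    exact_mod_cast ((div_lt_div_iff_of_pos_right hn').mp h).le
  have hkn : ∀ᶠ n in atTop, k n ≤ n := hle (b := fun n => n) (by linarith) hk hn1
  have hlm : ∀ᶠ n in atTop, l n ≤ m n := hle (by linarith) hl hm
  have hN : Tendsto (fun n : ℕ => ((n - k n : ℕ) : ℝ) / n) atTop (nhds (β + δ)) := by
    rw [show β + δ = 1 - κ by rw [hβdef, hδdef]; ring]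
    refine (hn1.sub hk).congr' ?_
    filter_upwards [hkn] with n hn
    rw [Nat.cast_sub hn, sub_div]
  have hM : Tendsto (fun n : ℕ => ((m n - l n : ℕ) : ℝ) / n) atTop (nhds β) := by
    rw [hβdef]
    refine (hm.sub hl).congr' ?_
    filter_upwards [hlm] with n hn
    rw [Nat.cast_sub hn, sub_div]
  have hlim : (1 / 2) * Real.log (β + δ) - (1 / 2) * Real.log (2 * π * ξ * (1 - ξ))
        + (1 / 2) * Real.log (2 * π * β * δ / (β + δ) ^ 2)
      = ((1 / 2) * (log 1 - log ξ - log (1 - ξ)) - (1 / 2) * log (2 * π))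
        - ((1 / 2) * (log (β + δ) - log β - log (β + δ - β)) - (1 / 2) * log (2 * π)) := by
    have hξ' : 1 - ξ ≠ 0 := (sub_pos.mpr hξ1).ne'
    rw [add_sub_cancel_left, log_one, log_div (by positivity) (by positivity), log_pow,
      log_mul (by positivity) hδ.ne', log_mul (by positivity) hβ.ne',
      log_mul (by positivity) hξ', log_mul (by positivity) hξ0.ne']
    push_cast
    ring
  rw [hlim]
  refine ((tendsto_log_choose_sub_mul_binH (N := fun n => n) hξ0 hξ1 hn1 hm).sub
    (tendsto_log_choose_sub_mul_binH hβ (lt_add_of_pos_right β hδ) hN hM)).congr' ?_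
  filter_upwards [hkn, hlm] with n hn hn'
  rw [Nat.cast_sub hn, Nat.cast_sub hn']
  ring
end

section
/- For all integers n, m, l with 0 ≤ l ≤ m and 2m ≤ n, the values p_{n,m,l}(x) for 0 ≤ x ≤ l are nonnegative and sum to 1: Σ_{x=0}^{l} (C(n,x)/C(n,m)) · (C(l,x)/C(m,x)) · ((n−2x+1)/(n−x+1)) · C(n−l−x, m−l) = 1. -/
/-- The mass `p_{n,m,l}(x)`. -/
def schurWeylMass (n m l x : ℕ) : ℚ :=
  ((n.choose x : ℚ) / (n.choose m)) * ((l.choose x : ℚ) / (m.choose x)) *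
    (((n : ℚ) - 2 * x + 1) / ((n : ℚ) - x + 1)) *
    (((n - l - x).choose (m - l) : ℚ))

/-- The Wilf–Zeilberger mate of `schurWeylMass` with respect to `l`. -/
def schurWeylMate (n m l x : ℕ) : ℚ :=
  -((x : ℚ) * ((m : ℚ) - x + 1) / ((l : ℚ) + 1)) *
    (((n.choose x : ℚ) / (n.choose m)) * (((l + 1).choose x : ℚ) / (m.choose x)) /
      ((n : ℚ) - x + 1)) * (((n - l - x).choose (m - l) : ℚ))

theorem Nat.cast_choose_succ_right_eq_div (n x : ℕ) (h : x ≤ n) :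
    (n.choose (x + 1) : ℚ) = n.choose x * ((n : ℚ) - x) / (x + 1) := by
  have := Nat.choose_succ_right_eq n x
  have h2 : (n.choose (x + 1) : ℚ) * (x + 1) = n.choose x * ((n : ℚ) - x) := by
    rw [← Nat.cast_sub h]; exact_mod_cast this
  rw [← h2]
  field_simp

theorem schurWeylMass_succ_sub (n m l x : ℕ) (hlm : l + 1 ≤ m) (hmn : 2 * m ≤ n) (hx : x ≤ l) :
    schurWeylMass n m (l + 1) x - schurWeylMass n m l x =
      schurWeylMate n m l (x + 1) - schurWeylMate n m l x := by
  obtain ⟨a, rfl⟩ := Nat.exists_eq_add_of_le hx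
  obtain ⟨b, rfl⟩ := Nat.exists_eq_add_of_le hlm
  obtain ⟨c, rfl⟩ := Nat.exists_eq_add_of_le hmn
  set n := 2 * (x + a + 1 + b) + c with hn
  set m := x + a + 1 + b with hm
  have hnQ : (n : ℚ) = 2 * (x + a + 1 + b) + c := by rw [hn, hm]; push_cast; ring
  have hmQ : (m : ℚ) = x + a + 1 + b := by rw [hm]; push_cast; ring
  have e1 := Nat.cast_choose_succ_right_eq_div n x (by lia)
  have e2 := Nat.cast_choose_succ_right_eq_div m x (by lia)
  have e3 : ((x + a + 1).choose (x + 1) : ℚ) =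
      (x + a + 1) * (x + a).choose x / (x + 1) := by
    have := Nat.add_one_mul_choose_eq (x + a) x
    rw [eq_div_iff (by positivity)]
    exact_mod_cast this.symm
  have e4 : ((x + a + 1).choose x : ℚ) = (x + a + 1) * (x + a).choose x / (a + 1) := by
    have := Nat.choose_mul_succ_eq (x + a) x
    rw [show x + a + 1 - x = a + 1 by lia] at this
    rw [eq_div_iff (by positivity), mul_comm ((x : ℚ) + a + 1)]
    exact_mod_cast this.symm
  obtain ⟨N, hN⟩ : ∃ N, N = a + 1 + 2 * b + c := ⟨_, rfl⟩
  have e5 : (N.choose b : ℚ) = (N + 1).choose (b + 1) * (b + 1) / (N + 1) := by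
    have := Nat.add_one_mul_choose_eq N b
    rw [eq_div_iff (by positivity), mul_comm]
    exact_mod_cast this
  have e6 : (N.choose (b + 1) : ℚ) = (N + 1).choose (b + 1) * (a + 1 + b + c) / (N + 1) := by
    have := Nat.choose_mul_succ_eq N (b + 1)
    rw [show N + 1 - (b + 1) = a + 1 + b + c by lia] at this
    rw [eq_div_iff (by positivity)]
    exact_mod_cast this
  have hNQ : (N : ℚ) = a + 1 + 2 * b + c := by rw [hN]; push_cast; ring
  have p1 : (n.choose m : ℚ) ≠ 0 := by exact_mod_cast (Nat.choose_pos (by lia)).ne'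
  have p2 : (m.choose x : ℚ) ≠ 0 := by exact_mod_cast (Nat.choose_pos (by lia)).ne'
  unfold schurWeylMass schurWeylMate
  rw [show n - (x + a + 1) - x = N by lia, show n - (x + a) - x = N + 1 by lia,
    show n - (x + a) - (x + 1) = N by lia, show m - (x + a + 1) = b by lia,
    show m - (x + a) = b + 1 by lia, e1, e2, e3, e4, e5, e6]
  generalize (n.choose m : ℚ) = P at *
  generalize (m.choose x : ℚ) = M at *
  generalize (n.choose x : ℚ) = A
  generalize ((x + a).choose x : ℚ) = B
  generalize ((N + 1).choose (b + 1) : ℚ) = D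
  rw [hNQ, hnQ, hmQ]
  push_cast
  have q1 : (2 * ((x : ℚ) + a + 1 + b) + c - x + 1) = x + 2 * a + 2 * b + c + 3 := by ring
  have q2 : (2 * ((x : ℚ) + a + 1 + b) + c - (x + 1) + 1) = x + 2 * a + 2 * b + c + 2 := by ring
  have q3 : (2 * ((x : ℚ) + a + 1 + b) + c - x) = x + 2 * a + 2 * b + c + 2 := by ring
  have q4 : ((x : ℚ) + a + 1 + b - x) = a + 1 + b := by ring
  rw [q1, q2, q3, q4]
  field_simp
  ring

theorem schurWeylMass_succ_self (n m l : ℕ) (hlm : l + 1 ≤ m) (hmn : 2 * m ≤ n) :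
    schurWeylMass n m (l + 1) (l + 1) = -schurWeylMate n m l (l + 1) := by
  obtain ⟨b, rfl⟩ := Nat.exists_eq_add_of_le hlm
  obtain ⟨c, rfl⟩ := Nat.exists_eq_add_of_le hmn
  obtain ⟨N, hN⟩ : ∃ N, N = 2 * b + c := ⟨_, rfl⟩
  have e : ((N : ℚ) + 1) * N.choose b = (N + 1).choose (b + 1) * (b + 1) := by
    exact_mod_cast Nat.add_one_mul_choose_eq N b
  have hNQ : (N : ℚ) = 2 * b + c := by rw [hN]; push_cast; ring
  unfold schurWeylMass schurWeylMate
  rw [show 2 * (l + 1 + b) + c - (l + 1) - (l + 1) = N by lia,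
    show 2 * (l + 1 + b) + c - l - (l + 1) = N + 1 by lia,
    show l + 1 + b - (l + 1) = b by lia, show l + 1 + b - l = b + 1 by lia, Nat.choose_self]
  generalize ((2 * (l + 1 + b) + c).choose (l + 1) : ℚ) /
    ((2 * (l + 1 + b) + c).choose (l + 1 + b) : ℚ) = A
  generalize ((Nat.cast 1 : ℚ) / ((l + 1 + b).choose (l + 1) : ℚ)) = B
  push_cast
  have q1 : (2 * ((l : ℚ) + 1 + b) + c - 2 * (l + 1) + 1) = N + 1 := by rw [hNQ]; ring
  have q2 : ((l : ℚ) + 1) * (l + 1 + b - (l + 1) + 1) / (l + 1) = b + 1 := by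
    field_simp; ring
  rw [q1, q2]
  linear_combination (A * B / (2 * ((l : ℚ) + 1 + b) + c - (l + 1) + 1)) * e

theorem sum_schurWeylMass (n m l : ℕ) (hlm : l ≤ m) (hmn : 2 * m ≤ n) :
    ∑ x ∈ Finset.range (l + 1), schurWeylMass n m l x = 1 := by
  induction l with
  | zero =>
    have p : (n.choose m : ℚ) ≠ 0 := by exact_mod_cast (Nat.choose_pos (by lia)).ne'
    have q : (n : ℚ) + 1 ≠ 0 := by positivity
    simp [schurWeylMass, p, q]
  | succ l ih =>
    have tel : ∑ x ∈ Finset.range (l + 1),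
        (schurWeylMass n m (l + 1) x - schurWeylMass n m l x) = schurWeylMate n m l (l + 1) := by
      rw [Finset.sum_congr rfl fun x hx => schurWeylMass_succ_sub n m l x hlm hmn
        (Nat.lt_succ_iff.mp (Finset.mem_range.mp hx)), Finset.sum_range_sub]
      simp [schurWeylMate]
    rw [Finset.sum_sub_distrib, ih (by lia)] at tel
    rw [Finset.sum_range_succ, schurWeylMass_succ_self n m l hlm hmn]
    linarith

theorem schurWeylMass_nonneg (n m l x : ℕ) (hlm : l ≤ m) (hmn : 2 * m ≤ n) (hx : x ≤ l) :
    0 ≤ schurWeylMass n m l x := by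
  have h : (2 * x : ℚ) ≤ n := by exact_mod_cast (show 2 * x ≤ n by lia)
  have h0 : (0 : ℚ) ≤ x := by positivity
  have h1 : (0 : ℚ) ≤ (n : ℚ) - 2 * x + 1 := by linarith
  have h2 : (0 : ℚ) ≤ (n : ℚ) - x + 1 := by linarith
  unfold schurWeylMass
  positivity


/-- the values `p_{n,m,l}(x)` are nonnegative and sum to one:
`Σ_{x=0}^{l} (C(n,x)/C(n,m))·(C(l,x)/C(m,x))·((n−2x+1)/(n−x+1))·C(n−l−x, m−l) = 1`. -/
theorem statement_9 (n m l : ℕ) (hlm : l ≤ m) (hmn : 2 * m ≤ n) :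
    (∀ x ≤ l, 0 ≤
      ((n.choose x : ℚ) / (n.choose m)) * ((l.choose x : ℚ) / (m.choose x)) *
        (((n : ℚ) - 2 * x + 1) / ((n : ℚ) - x + 1)) *
        (((n - l - x).choose (m - l) : ℚ))) ∧
    ∑ x ∈ Finset.range (l + 1),
      ((n.choose x : ℚ) / (n.choose m)) * ((l.choose x : ℚ) / (m.choose x)) *
        (((n : ℚ) - 2 * x + 1) / ((n : ℚ) - x + 1)) *
        (((n - l - x).choose (m - l) : ℚ)) = 1 := by
  exact ⟨fun x hx => schurWeylMass_nonneg n m l x hlm hmn hx, sum_schurWeylMass n m l hlm hmn⟩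
end

section
/- Fix an integer l ≥ 0 and a rational ξ ∈ (0, 1/2]. There exists a constant C > 0 such that for all n with m := ξn ∈ ℤ and m ≥ l, and all integers 0 ≤ x ≤ l, one has |p_{n,m,l}(x) − C(l,x)·(1−ξ)^x·ξ^{l−x}| ≤ C/n. (That is, in the Type I limit with k = l the distribution p_{n,m,l} converges, with error O(1/n), to the binomial distribution B_{1−ξ,l}.) -/
/-- The Schur–Weyl measurement outcome distribution
`p_{n,m,l}(x) = (C(n,x)/C(n,m))·(C(l,x)/C(m,x))·((n−2x+1)/(n−x+1))·C(n−l−x, m−l)`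
for `0 ≤ x ≤ l` (intended for `0 ≤ l ≤ m` and `2m ≤ n`). -/
noncomputable def pSW (n m l x : ℕ) : ℝ :=
  ((n.choose x : ℝ) / (n.choose m)) * ((l.choose x : ℝ) / (m.choose x)) *
    (((n : ℝ) - 2 * x + 1) / ((n : ℝ) - x + 1)) *
    (((n - l - x).choose (m - l) : ℝ))

open Filter Topology Asymptotics in
/-- A sequence sampling a function differentiable at `0` at the points `1 / n` converges to the
value at `0` with error `O(1 / n)`, uniformly in `n ≥ 1`. -/
theorem exists_abs_sub_le_div_of_differentiableAt {g : ℝ → ℝ} (hg : DifferentiableAt ℝ g 0) :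
    ∃ C : ℝ, 0 < C ∧ ∀ n : ℕ, n ≠ 0 → |g (n : ℝ)⁻¹ - g 0| ≤ C / n := by
  have hO : (fun n : ℕ => g (n : ℝ)⁻¹ - g 0) =O[atTop] fun n : ℕ => (n : ℝ)⁻¹ := by
    have h := hg.isBigO_sub.comp_tendsto (tendsto_inv_atTop_nhds_zero_nat (𝕜 := ℝ))
    simpa [Function.comp_def] using h
  obtain ⟨C, hC, h⟩ := bound_of_isBigO_nat_atTop hO
  refine ⟨C, hC, fun n hn => ?_⟩
  have := h (x := n) (by positivity)
  simpa [div_eq_mul_inv] using this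

/-- The falling product `a (a - t) ⋯ (a - (k - 1) t)`. -/
noncomputable def fallingProd (a : ℝ) (k : ℕ) (t : ℝ) : ℝ :=
  ∏ i ∈ Finset.range k, (a - i * t)

theorem fallingProd_zero (a : ℝ) (k : ℕ) : fallingProd a k 0 = a ^ k := by
  simp [fallingProd]

theorem differentiable_fallingProd (a : ℝ) (k : ℕ) : Differentiable ℝ (fallingProd a k) := by
  unfold fallingProd
  fun_prop

theorem cast_descFactorial_eq_pow_mul_fallingProd {n A : ℕ} (hn : n ≠ 0) {a : ℝ}
    (ha : (A : ℝ) = a * n) (k : ℕ) :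
    (A.descFactorial k : ℝ) = (n : ℝ) ^ k * fallingProd a k (n : ℝ)⁻¹ := by
  have hn' : (n : ℝ) ≠ 0 := by exact_mod_cast hn
  simp only [← descPochhammer_eval_eq_descFactorial, descPochhammer_eval_eq_prod_range, fallingProd]
  rw [← Finset.card_range k, ← Finset.prod_const, Finset.card_range, ← Finset.prod_mul_distrib]
  refine Finset.prod_congr rfl fun i _ => ?_
  rw [ha]
  field_simp

theorem choose_mul_descFactorial_add {n m l x : ℕ} (hl : l ≤ m) (hx : x + m ≤ n) :
    (n - l - x).choose (m - l) * n.descFactorial (l + x) =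
      n.choose m * (m.descFactorial l * (n - m).descFactorial x) := by
  have e1 := Nat.factorial_mul_descFactorial (n := n) (k := l + x) (by omega)
  have e2 := Nat.factorial_mul_descFactorial hl
  have e3 := Nat.factorial_mul_descFactorial (n := n - m) (k := x) (by omega)
  have e4 := Nat.choose_mul_factorial_mul_factorial (n := n) (k := m) (by omega)
  have e5 := Nat.choose_mul_factorial_mul_factorial (n := n - l - x) (k := m - l) (by omega)
  rw [show n - l - x - (m - l) = n - m - x by omega] at e5
  rw [show n - (l + x) = n - l - x by omega] at e1
  have hpos : 0 < (m - l).factorial * (n - m - x).factorial := by positivity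
  apply Nat.eq_of_mul_eq_mul_right hpos
  calc _ = (n - l - x).choose (m - l) * (m - l).factorial * (n - m - x).factorial *
        n.descFactorial (l + x) := by ring
    _ = n.choose m * ((m - l).factorial * m.descFactorial l) *
        ((n - m - x).factorial * (n - m).descFactorial x) := by rw [e5, e1, e2, e3, e4]
    _ = _ := by ring

/-- The function of `t = 1 / n` that gives `pSW n (ξ n) l x`. -/
noncomputable def pSWScaled (ξ : ℝ) (l x : ℕ) (t : ℝ) : ℝ :=
  (l.choose x : ℝ) * (fallingProd 1 x t / fallingProd ξ x t) *
    ((1 + (1 - 2 * x) * t) / (1 + (1 - x) * t)) *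
    (fallingProd ξ l t * fallingProd (1 - ξ) x t / fallingProd 1 (l + x) t)

theorem differentiableAt_pSWScaled {ξ : ℝ} (hξ : ξ ≠ 0) (l x : ℕ) :
    DifferentiableAt ℝ (pSWScaled ξ l x) 0 := by
  have h (a : ℝ) (k : ℕ) := (differentiable_fallingProd a k).differentiableAt (x := 0)
  have h1 : fallingProd ξ x 0 ≠ 0 := by rw [fallingProd_zero]; positivity
  have h2 : fallingProd 1 (l + x) 0 ≠ 0 := by simp [fallingProd_zero]
  unfold pSWScaled
  refine .mul (.mul (.mul (by fun_prop) ((h _ _).div (h _ _) h1)) ?_)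
    (((h _ _).mul (h _ _)).div (h _ _) h2)
  exact .div (by fun_prop) (by fun_prop) (by simp)

theorem pSWScaled_zero {ξ : ℝ} (hξ : ξ ≠ 0) {l x : ℕ} (hx : x ≤ l) :
    pSWScaled ξ l x 0 = (l.choose x : ℝ) * (1 - ξ) ^ x * ξ ^ (l - x) := by
  simp only [pSWScaled, fallingProd_zero, pow_sub₀ ξ hξ hx]
  simp
  ring

theorem pSW_eq_pSWScaled {n m l x : ℕ} {ξ : ℝ} (hn : n ≠ 0) (hm : (m : ℝ) = ξ * n)
    (hl : l ≤ m) (hmn : x + m ≤ n) :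
    pSW n m l x = pSWScaled ξ l x (n : ℝ)⁻¹ := by
  have hn' : (n : ℝ) ≠ 0 := by exact_mod_cast hn
  have d1 (k : ℕ) := cast_descFactorial_eq_pow_mul_fallingProd hn (one_mul (n : ℝ)).symm k
  have d2 (k : ℕ) := cast_descFactorial_eq_pow_mul_fallingProd hn hm k
  have d3 (k : ℕ) := cast_descFactorial_eq_pow_mul_fallingProd hn (A := n - m) (a := 1 - ξ)
    (by rw [Nat.cast_sub (by omega), hm]; ring) k
  have hc : (n.choose m : ℝ) ≠ 0 := by exact_mod_cast (Nat.choose_pos (by omega)).ne'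
  have hd : (n.descFactorial (l + x) : ℝ) ≠ 0 := by
    rw [Nat.cast_ne_zero, Ne, Nat.descFactorial_eq_zero_iff_lt]; omega
  have r1 : ((n - l - x).choose (m - l) : ℝ) / n.choose m =
      fallingProd ξ l (n : ℝ)⁻¹ * fallingProd (1 - ξ) x (n : ℝ)⁻¹ /
        fallingProd 1 (l + x) (n : ℝ)⁻¹ := by
    calc ((n - l - x).choose (m - l) : ℝ) / n.choose m
        = m.descFactorial l * (n - m).descFactorial x / n.descFactorial (l + x) := by
          rw [div_eq_div_iff hc hd]
          exact_mod_cast (choose_mul_descFactorial_add hl hmn).trans (mul_comm _ _)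
      _ = _ := by
          rw [d1, d2, d3, pow_add, mul_mul_mul_comm, mul_div_mul_left _ _ (by positivity)]
  have r2 : (n.choose x : ℝ) / m.choose x =
      fallingProd 1 x (n : ℝ)⁻¹ / fallingProd ξ x (n : ℝ)⁻¹ := by
    rw [← mul_div_mul_left _ _ (show (x.factorial : ℝ) ≠ 0 by positivity)]
    rw [← Nat.cast_mul, ← Nat.cast_mul, ← Nat.descFactorial_eq_factorial_mul_choose,
      ← Nat.descFactorial_eq_factorial_mul_choose, d1, d2, mul_div_mul_left _ _ (by positivity)]
  have r3 : ((n : ℝ) - 2 * x + 1) / (n - x + 1) =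
      (1 + (1 - 2 * x) * (n : ℝ)⁻¹) / (1 + (1 - x) * (n : ℝ)⁻¹) := by
    rw [← mul_div_mul_left (1 + (1 - 2 * (x : ℝ)) * (n : ℝ)⁻¹) _ hn']
    congr 1 <;> field_simp <;> ring
  rw [pSWScaled, ← r1, ← r2, ← r3, pSW]
  ring

/-- Type I limit with `k = l`: `p_{n,m,l}` converges, with error
`O(1/n)`, to the binomial distribution `B_{1−ξ, l}`. -/
theorem statement_10 (l : ℕ) (ξ : ℚ) (h0 : 0 < ξ) (h1 : ξ ≤ 1 / 2) :
    ∃ C : ℝ, 0 < C ∧ ∀ n m : ℕ, (m : ℚ) = ξ * n → l ≤ m →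
      ∀ x ≤ l,
        |pSW n m l x -
          (l.choose x : ℝ) * (1 - (ξ : ℝ)) ^ x * (ξ : ℝ) ^ (l - x)| ≤ C / n := by
  have hξ : (ξ : ℝ) ≠ 0 := by exact_mod_cast h0.ne'
  choose C hC hbound using fun x : ℕ =>
    exists_abs_sub_le_div_of_differentiableAt (differentiableAt_pSWScaled hξ l x)
  refine ⟨∑ x ∈ Finset.range (l + 1), C x,
    Finset.sum_pos (fun x _ => hC x) Finset.nonempty_range_add_one, fun n m hm hl x hx => ?_⟩
  have hm' : (m : ℝ) = (ξ : ℝ) * n := by exact_mod_cast congrArg (Rat.cast : ℚ → ℝ) hm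
  have hmn : 2 * m ≤ n := by
    have : (2 * m : ℚ) ≤ n := by
      rw [hm]; nlinarith [(Nat.cast_nonneg n : (0 : ℚ) ≤ n)]
    exact_mod_cast this
  rcases eq_or_ne n 0 with rfl | hn
  · obtain rfl : m = 0 := by omega
    obtain rfl : l = 0 := by omega
    obtain rfl : x = 0 := by omega
    simp [pSW]
  · rw [pSW_eq_pSWScaled hn hm' hl (by omega),
      ← pSWScaled_zero hξ hx]
    refine (hbound x n hn).trans ?_
    gcongr
    exact Finset.single_le_sum (f := C) (fun y _ => (hC y).le)
      (Finset.mem_range.2 (Nat.lt_succ_of_le hx))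
end

section
/- Fix rationals α, ξ with 0 < α < ξ ≤ 1/2, and set μ := (1 − √(1 − 4α(1−ξ)))/2. For each n such that l := αn and m := ξn are integers, let X_n be a random variable with probability mass function p_{n,m,l}. Then for every ε > 0, the probability P(|X_n/n − μ| > ε) tends to 0 as n → ∞ along such n; in particular E[X_n] = nμ + o(n). -/
/-- For a rational ratio `θ`, the natural number `⌊θ n⌋`; on the set `exactSet`
below this equals `θ n` exactly. -/
def ratIdx (θ : ℚ) (n : ℕ) : ℕ := ⌊θ * n⌋₊

/-- The set of `n` for which both `α n` and `ξ n` are (natural) integers. -/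
def exactSet (α ξ : ℚ) : Set ℕ :=
  {n : ℕ | ((ratIdx α n : ℚ) = α * n) ∧ ((ratIdx ξ n : ℚ) = ξ * n)}

lemma pSW_nonneg {n m l x : ℕ} (hlm : l ≤ m) (hmn : 2 * m ≤ n) (hx : x ≤ l) :
    0 ≤ pSW n m l x := by
  have h : (2 * x : ℝ) ≤ n := by exact_mod_cast (by omega : 2 * x ≤ n)
  have hx0 : (0 : ℝ) ≤ x := x.cast_nonneg
  have h1 : (0 : ℝ) ≤ (n : ℝ) - 2 * x + 1 := by linarith
  have h2 : (0 : ℝ) ≤ (n : ℝ) - x + 1 := by linarith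
  unfold pSW
  positivity

lemma pSW_eq_zero_of_lt {n m l x : ℕ} (hx : l < x) : pSW n m l x = 0 := by
  simp [pSW, Nat.choose_eq_zero_of_lt hx]

/-- Lowering `l` by one multiplies the weight by a quadratic polynomial in `x`. -/
lemma mul_pSW_succ {n m l x : ℕ} (hlm : l + 1 ≤ m) (hmn : 2 * m ≤ n) (hx : x ≤ l + 1) :
    ((l : ℝ) + 1 - x) * (n - l - x) * pSW n m (l + 1) x = (l + 1) * (m - l) * pSW n m l x := by
  have e1 : ((l + 1).choose x : ℝ) * (l + 1 - x) = l.choose x * (l + 1) := by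
    have := Nat.choose_mul_succ_eq l x
    rw [← Nat.cast_inj (R := ℝ)] at this
    push_cast [Nat.cast_sub hx] at this
    linarith
  have e2 : ((n - (l + 1) - x).choose (m - (l + 1)) : ℝ) * (n - l - x) =
      (n - l - x).choose (m - l) * (m - l) := by
    have := Nat.add_one_mul_choose_eq (n - (l + 1) - x) (m - (l + 1))
    rw [show n - (l + 1) - x + 1 = n - l - x by omega,
      show m - (l + 1) + 1 = m - l by omega, ← Nat.cast_inj (R := ℝ)] at this
    push_cast [Nat.cast_sub (by omega : x ≤ n - l), Nat.cast_sub (by omega : l ≤ n),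
      Nat.cast_sub (by omega : l ≤ m)] at this
    linarith
  unfold pSW
  calc _ = ((n.choose x : ℝ) / (n.choose m)) * (((l + 1).choose x * ((l : ℝ) + 1 - x)) /
        (m.choose x)) * (((n : ℝ) - 2 * x + 1) / ((n : ℝ) - x + 1)) *
        (((n - (l + 1) - x).choose (m - (l + 1)) : ℝ) * (n - l - x)) := by ring
    _ = _ := by rw [e1, e2]; ring

/-- The ratio of consecutive values of the weight. -/
lemma pSW_ratio {n m l x : ℕ} (hlm : l ≤ m) (hmn : 2 * m ≤ n) (hx : x < l) :
    ((l : ℝ) - x) * (n - m - x) * (n + 1 - x) / (n + 1 - 2 * x) * pSW n m l x =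
      ((x : ℝ) + 1) * (m - x) * (n - l - x) / (n - 1 - 2 * x) * pSW n m l (x + 1) := by
  have hn : (2 * x + 2 : ℝ) ≤ n := by exact_mod_cast (by omega : 2 * x + 2 ≤ n)
  have hmx : (x + 1 : ℝ) ≤ m := by exact_mod_cast (by omega : x + 1 ≤ m)
  have hx0 : (0 : ℝ) ≤ x := x.cast_nonneg
  have step (N : ℕ) (h : x ≤ N) :
      (N.choose (x + 1) : ℝ) = N.choose x * (N - x) / (x + 1) := by
    have := Nat.choose_succ_right_eq N x
    rw [← Nat.cast_inj (R := ℝ)] at this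
    push_cast [Nat.cast_sub h] at this
    rw [eq_div_iff (by positivity), this]
  have e : ((n - l - (x + 1)).choose (m - l) : ℝ) * (n - l - x) =
      (n - l - x).choose (m - l) * (n - m - x) := by
    have := Nat.choose_mul_succ_eq (n - l - (x + 1)) (m - l)
    rw [show n - l - (x + 1) + 1 = n - l - x by omega,
      show n - l - x - (m - l) = n - m - x by omega, ← Nat.cast_inj (R := ℝ)] at this
    push_cast [Nat.cast_sub (by omega : x ≤ n - l), Nat.cast_sub (by omega : l ≤ n),
      Nat.cast_sub (by omega : x ≤ n - m), Nat.cast_sub (by omega : m ≤ n)] at this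
    exact this
  have c1 : (n.choose m : ℝ) ≠ 0 := by
    exact_mod_cast (Nat.choose_pos (by omega : m ≤ n)).ne'
  have c2 : (m.choose x : ℝ) ≠ 0 := by
    exact_mod_cast (Nat.choose_pos (by omega : x ≤ m)).ne'
  have d1 : (n : ℝ) + 1 - 2 * x ≠ 0 := by linarith
  have d2 : (n : ℝ) - 1 - 2 * x ≠ 0 := by linarith
  have d3 : (n : ℝ) + 1 - x ≠ 0 := by linarith
  have d4 : (n : ℝ) - x ≠ 0 := by linarith
  have d5 : (m : ℝ) - x ≠ 0 := by linarith
  have d6 : (x : ℝ) + 1 ≠ 0 := by linarith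
  unfold pSW
  rw [step n (by omega), step l (by omega), step m (by omega)]
  push_cast
  rw [show (n : ℝ) - 2 * (x + 1) + 1 = n - 1 - 2 * x by ring,
    show (n : ℝ) - (x + 1) + 1 = n - x by ring,
    show (n : ℝ) - 2 * x + 1 = n + 1 - 2 * x by ring,
    show (n : ℝ) - x + 1 = n + 1 - x by ring]
  generalize (n : ℝ) + 1 - 2 * x = D₁ at *
  generalize (n : ℝ) - 1 - 2 * x = D₂ at *
  trans ((l : ℝ) - x) * n.choose x * l.choose x / (n.choose m * m.choose x) *
    ((n - l - x).choose (m - l) * (n - m - x))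
  · field_simp
  · rw [← e]
    field_simp

/-- A discrete integration by parts against the weight. -/
lemma sum_casimir_sub_mul_pSW {n m l : ℕ} (hlm : l ≤ m) (hmn : 2 * m ≤ n) :
    ∑ x ∈ Finset.range (l + 1), ((l : ℝ) * (n - m) - x * (n + 1 - x)) * pSW n m l x = 0 := by
  have key : ∀ x ∈ Finset.range (l + 1),
      ((l : ℝ) * (n - m) - x * (n + 1 - x)) * pSW n m l x =
        ((l : ℝ) - x) * (n - m - x) * (n + 1 - x) / (n + 1 - 2 * x) * pSW n m l x -
        (x : ℝ) * (m + 1 - x) * (n - l + 1 - x) / (n + 1 - 2 * x) * pSW n m l x := by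
    intro x hx
    rw [Finset.mem_range] at hx
    have hn : (2 * x : ℝ) ≤ n := by exact_mod_cast (by omega : 2 * x ≤ n)
    have d1 : (n : ℝ) + 1 - 2 * x ≠ 0 := by linarith
    rw [← sub_mul, ← sub_div]
    congr 1
    rw [eq_div_iff d1]
    ring
  rw [Finset.sum_congr rfl key, Finset.sum_sub_distrib, Finset.sum_range_succ,
    Finset.sum_range_succ' (fun x : ℕ =>
      (x : ℝ) * (m + 1 - x) * (n - l + 1 - x) / (n + 1 - 2 * x) * pSW n m l x)]
  have shift : ∀ x ∈ Finset.range l,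
      ((l : ℝ) - x) * (n - m - x) * (n + 1 - x) / (n + 1 - 2 * x) * pSW n m l x =
        ((x + 1 : ℕ) : ℝ) * (m + 1 - (x + 1 : ℕ)) * (n - l + 1 - (x + 1 : ℕ)) /
          (n + 1 - 2 * (x + 1 : ℕ)) * pSW n m l (x + 1) := by
    intro x hx
    rw [pSW_ratio hlm hmn (Finset.mem_range.mp hx)]
    push_cast
    congr 2 <;> ring
  rw [Finset.sum_congr rfl shift]
  simp

/-- The weights sum to one. -/
lemma sum_pSW {n m l : ℕ} (hlm : l ≤ m) (hmn : 2 * m ≤ n) :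
    ∑ x ∈ Finset.range (l + 1), pSW n m l x = 1 := by
  induction l with
  | zero =>
    have c1 : (n.choose m : ℝ) ≠ 0 := by
      exact_mod_cast (Nat.choose_pos (by omega : m ≤ n)).ne'
    have : (n : ℝ) + 1 ≠ 0 := by positivity
    simp [pSW, c1, this]
  | succ l ih =>
    specialize ih (by omega)
    have hm : (l + 1 : ℝ) ≤ m := by exact_mod_cast hlm
    have hl0 : (0 : ℝ) ≤ l := l.cast_nonneg
    have hc : ((l : ℝ) + 1) * (m - l) ≠ 0 := by
      have : (0 : ℝ) < m - l := by linarith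
      positivity
    have key : ∀ x ∈ Finset.range (l + 1 + 1),
        (((l + 1 : ℕ) : ℝ) * (n - m) - x * (n + 1 - x)) * pSW n m (l + 1) x =
          ((l : ℝ) + 1) * (m - l) * pSW n m l x -
            ((l : ℝ) + 1) * (m - l) * pSW n m (l + 1) x := by
      intro x hx
      rw [Finset.mem_range] at hx
      rw [← mul_pSW_succ hlm hmn (by omega)]
      push_cast
      ring
    have h := sum_casimir_sub_mul_pSW hlm hmn
    rw [Finset.sum_congr rfl key, Finset.sum_sub_distrib, ← Finset.mul_sum, ← Finset.mul_sum,
      Finset.sum_range_succ, ih, pSW_eq_zero_of_lt (Nat.lt_succ_self l), ← mul_sub] at h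
    have := (mul_eq_zero.mp h).resolve_left hc
    linarith

lemma sum_mul_pSW_succ {n m l : ℕ} (hlm : l + 1 ≤ m) (hmn : 2 * m ≤ n) (φ : ℕ → ℝ) :
    ∑ x ∈ Finset.range (l + 2), φ x * (((l : ℝ) + 1 - x) * (n - l - x) * pSW n m (l + 1) x) =
      ((l : ℝ) + 1) * (m - l) * ∑ x ∈ Finset.range (l + 1), φ x * pSW n m l x := by
  rw [Finset.mul_sum, Finset.sum_range_succ _ (l + 1),
    mul_pSW_succ hlm hmn le_rfl, pSW_eq_zero_of_lt (Nat.lt_succ_self l), mul_zero, mul_zero,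
    add_zero]
  refine Finset.sum_congr rfl fun x hx => ?_
  rw [mul_pSW_succ hlm hmn (Finset.mem_range.mp hx).le]
  ring

/-- The variance of the Casimir-type statistic `x (n + 1 - x)`. -/
lemma sum_casimir_sub_sq_mul_pSW {n m l : ℕ} (hlm : l + 1 ≤ m) (hmn : 2 * m ≤ n) :
    ∑ x ∈ Finset.range (l + 2),
        ((x : ℝ) * (n + 1 - x) - (l + 1) * (n - m)) ^ 2 * pSW n m (l + 1) x =
      ((l : ℝ) + 1) * (m - l) * (n - m) := by
  have s0 := sum_pSW hlm hmn
  have s1 := sum_casimir_sub_mul_pSW hlm hmn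
  have s2 := sum_casimir_sub_mul_pSW (by omega : l ≤ m) hmn
  have s3 := sum_mul_pSW_succ hlm hmn fun x => (l : ℝ) * (n - m) - x * (n + 1 - x)
  rw [s2, mul_zero] at s3
  have key : ∀ x ∈ Finset.range (l + 2),
      ((x : ℝ) * (n + 1 - x) - (l + 1) * (n - m)) ^ 2 * pSW n m (l + 1) x =
        ((l : ℝ) * (n - m) - x * (n + 1 - x)) *
            (((l : ℝ) + 1 - x) * (n - l - x) * pSW n m (l + 1) x) +
          ((n : ℝ) - m - (l + 1) * (m - l)) *
            ((((l + 1 : ℕ) : ℝ) * (n - m) - x * (n + 1 - x)) * pSW n m (l + 1) x) +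
          ((l : ℝ) + 1) * (m - l) * (n - m) * pSW n m (l + 1) x := by
    intro x _
    push_cast
    ring
  rw [Finset.sum_congr rfl key, Finset.sum_add_distrib, Finset.sum_add_distrib, s3,
    ← Finset.mul_sum, s1, ← Finset.mul_sum, s0]
  ring

lemma sum_sub_sq_mul_pSW_le {n m l : ℕ} (hl : 1 ≤ l) (hlm : l ≤ m) (hmn : 2 * m ≤ n)
    {μ δ : ℝ} (hδ : 0 < δ) (hμ : n ^ 2 * (μ * (1 - μ)) = l * (n - m))
    (hgap : n * δ ≤ n - n * μ - l) :
    ∑ x ∈ Finset.range (l + 1), ((x : ℝ) / n - μ) ^ 2 * pSW n m l x ≤ 4 / δ ^ 2 / n := by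
  obtain ⟨l, rfl⟩ := Nat.exists_eq_add_of_le' hl
  have hv := sum_casimir_sub_sq_mul_pSW hlm hmn
  have s0 := sum_pSW hlm hmn
  have hn1 : (1 : ℝ) ≤ n := by exact_mod_cast (by omega : 1 ≤ n)
  have hl' : (l + 1 : ℝ) ≤ n := by exact_mod_cast (by omega : l + 1 ≤ n)
  have hlm' : (l + 1 : ℝ) ≤ m := by exact_mod_cast hlm
  have hmn' : (m : ℝ) ≤ n := by exact_mod_cast (by omega : m ≤ n)
  have hl0 : (0 : ℝ) ≤ l := l.cast_nonneg
  have hvar : ((l : ℝ) + 1) * (m - l) * (n - m) ≤ n ^ 3 := by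
    rw [show (n : ℝ) ^ 3 = n * n * n by ring]
    gcongr <;> linarith
  push_cast at hgap hμ
  have key : ∀ x ∈ Finset.range (l + 1 + 1),
      n ^ 4 * δ ^ 2 * (((x : ℝ) / n - μ) ^ 2 * pSW n m (l + 1) x) ≤
        2 * (((x : ℝ) * (n + 1 - x) - (l + 1) * (n - m)) ^ 2 * pSW n m (l + 1) x) +
          2 * n ^ 2 * pSW n m (l + 1) x := by
    intro x hx
    rw [Finset.mem_range] at hx
    have hp := pSW_nonneg hlm hmn (by omega : x ≤ l + 1)
    have hxl : (x : ℝ) ≤ l + 1 := by exact_mod_cast (by omega : x ≤ l + 1)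
    have hx0 : (0 : ℝ) ≤ x := x.cast_nonneg
    have e : (n : ℝ) ^ 4 * δ ^ 2 * ((x : ℝ) / n - μ) ^ 2 = (n * δ) ^ 2 * (x - n * μ) ^ 2 := by
      field_simp
    have e2 : (x - n * μ) * (n - n * μ - x) =
        ((x : ℝ) * (n + 1 - x) - (l + 1) * (n - m)) - x := by
      rw [← hμ]; ring
    have i1 : (n * δ) ^ 2 * (x - n * μ) ^ 2 ≤ (n - n * μ - x) ^ 2 * (x - n * μ) ^ 2 := by
      gcongr
      linarith
    have i2 : (n - n * μ - x) ^ 2 * (x - n * μ) ^ 2 ≤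
        2 * ((x : ℝ) * (n + 1 - x) - (l + 1) * (n - m)) ^ 2 + 2 * n ^ 2 := by
      rw [← mul_pow, mul_comm, e2]
      have : (x : ℝ) ^ 2 ≤ n ^ 2 := by gcongr; linarith
      nlinarith [sq_nonneg (((x : ℝ) * (n + 1 - x) - (l + 1) * (n - m)) + x)]
    rw [← mul_assoc, e]
    exact (mul_le_mul_of_nonneg_right (i1.trans i2) hp).trans_eq (by ring)
  have h := Finset.sum_le_sum key
  rw [← Finset.mul_sum, Finset.sum_add_distrib, ← Finset.mul_sum, ← Finset.mul_sum, s0, hv] at h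
  rw [div_div, le_div_iff₀ (by positivity)]
  have h3 : (n : ℝ) ^ 2 ≤ n ^ 3 := pow_le_pow_right₀ hn1 (by norm_num)
  have hn3 : (0 : ℝ) < n ^ 3 := by positivity
  refine le_of_mul_le_mul_left ?_ hn3
  generalize ∑ x ∈ Finset.range (l + 1 + 1), ((x : ℝ) / n - μ) ^ 2 * pSW n m (l + 1) x = S at *
  have e : (n : ℝ) ^ 3 * (S * (δ ^ 2 * n)) = n ^ 4 * δ ^ 2 * S := by ring
  rw [e]
  linarith

lemma sum_ite_le_sum_sq_div {s : Finset ℕ} {p t : ℕ → ℝ} (hp : ∀ x ∈ s, 0 ≤ p x) {ε : ℝ}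
    (hε : 0 < ε) :
    ∑ x ∈ s, (if ε < |t x| then p x else 0) ≤ (∑ x ∈ s, t x ^ 2 * p x) / ε ^ 2 := by
  rw [Finset.sum_div]
  refine Finset.sum_le_sum fun x hx => ?_
  have := hp x hx
  split_ifs with h
  · rw [le_div_iff₀ (by positivity), mul_comm, ← sq_abs (t x)]
    gcongr
  · positivity

lemma sq_sum_mul_le {s : Finset ℕ} {p t : ℕ → ℝ} (hp : ∀ x ∈ s, 0 ≤ p x)
    (h1 : ∑ x ∈ s, p x = 1) :
    (∑ x ∈ s, t x * p x) ^ 2 ≤ ∑ x ∈ s, t x ^ 2 * p x := by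
  have e (T : ℝ) : ∑ x ∈ s, (t x - T) ^ 2 * p x =
      ∑ x ∈ s, t x ^ 2 * p x - 2 * T * ∑ x ∈ s, t x * p x + T ^ 2 * ∑ x ∈ s, p x := by
    rw [Finset.mul_sum, Finset.mul_sum, ← Finset.sum_sub_distrib, ← Finset.sum_add_distrib]
    exact Finset.sum_congr rfl fun x _ => by ring
  have h : 0 ≤ ∑ x ∈ s, (t x - ∑ y ∈ s, t y * p y) ^ 2 * p x :=
    Finset.sum_nonneg fun x hx => mul_nonneg (sq_nonneg _) (hp x hx)
  rw [e, h1] at h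
  nlinarith

open Filter in
/-- law of large numbers for `p_{n,m,l}`, Type II limit with
`k = l`: with `l = αn`, `m = ξn`, the random variable `X_n/n` concentrates at
`μ = (1 − √(1 − 4α(1−ξ)))/2`, and `E[X_n] = nμ + o(n)`, along those `n` for
which `αn` and `ξn` are integers. -/
theorem statement_11 (α ξ : ℚ) (h0 : 0 < α) (h1 : α < ξ) (h2 : ξ ≤ 1 / 2)
    (μ : ℝ) (hμ : μ = (1 - Real.sqrt (1 - 4 * (α : ℝ) * (1 - (ξ : ℝ)))) / 2) :
    (∀ ε : ℝ, 0 < ε →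
      Tendsto (fun n : ℕ =>
          ∑ x ∈ Finset.range (ratIdx α n + 1),
            if ε < |(x : ℝ) / n - μ| then pSW n (ratIdx ξ n) (ratIdx α n) x else 0)
        (atTop ⊓ Filter.principal (exactSet α ξ)) (nhds 0)) ∧
    Tendsto (fun n : ℕ =>
        ((∑ x ∈ Finset.range (ratIdx α n + 1),
            (x : ℝ) * pSW n (ratIdx ξ n) (ratIdx α n) x) - n * μ) / n)
      (atTop ⊓ Filter.principal (exactSet α ξ)) (nhds 0) := by
  have h0' : (0 : ℝ) < α := by exact_mod_cast h0
  have h1' : (α : ℝ) < ξ := by exact_mod_cast h1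
  have h2' : (ξ : ℝ) ≤ 1 / 2 := by
    have : ((ξ : ℚ) : ℝ) ≤ ((1 / 2 : ℚ) : ℝ) := by exact_mod_cast h2
    simpa using this
  have hdisc : 0 ≤ 1 - 4 * (α : ℝ) * (1 - ξ) := by nlinarith
  have hμ2 : μ ≤ 1 / 2 := by
    have := Real.sqrt_nonneg (1 - 4 * (α : ℝ) * (1 - ξ))
    linarith
  have hμeq : μ * (1 - μ) = α * (1 - ξ) := by
    have := Real.sq_sqrt hdisc
    rw [hμ]
    nlinarith
  have hδ : (0 : ℝ) < 1 / 2 - α := by linarith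
  have hfacts : ∀ᶠ n : ℕ in atTop ⊓ Filter.principal (exactSet α ξ), 1 ≤ n ∧
      ratIdx α n ≤ ratIdx ξ n ∧ 2 * ratIdx ξ n ≤ n ∧
      ∑ x ∈ Finset.range (ratIdx α n + 1),
        ((x : ℝ) / n - μ) ^ 2 * pSW n (ratIdx ξ n) (ratIdx α n) x ≤
          4 / (1 / 2 - (α : ℝ)) ^ 2 / n := by
    rw [eventually_inf_principal]
    filter_upwards [eventually_ge_atTop 1] with n hn ⟨hl, hm⟩
    have hnq : (1 : ℚ) ≤ n := by exact_mod_cast hn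
    have hl1 : 1 ≤ ratIdx α n := by
      have : (0 : ℚ) < ratIdx α n := by rw [hl]; positivity
      exact_mod_cast this
    have hlm : ratIdx α n ≤ ratIdx ξ n := by
      rw [← Nat.cast_le (α := ℚ), hl, hm]
      gcongr
    have hmn : 2 * ratIdx ξ n ≤ n := by
      rw [← Nat.cast_le (α := ℚ)]
      push_cast
      rw [hm]
      nlinarith
    have hlr : (ratIdx α n : ℝ) = α * n := by exact_mod_cast congrArg (Rat.cast : ℚ → ℝ) hl
    have hmr : (ratIdx ξ n : ℝ) = ξ * n := by exact_mod_cast congrArg (Rat.cast : ℚ → ℝ) hm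
    have hnr : (1 : ℝ) ≤ n := by exact_mod_cast hn
    refine ⟨hn, hlm, hmn, sum_sub_sq_mul_pSW_le hl1 hlm hmn hδ ?_ ?_⟩
    · rw [hμeq, hlr, hmr]; ring
    · rw [hlr]; nlinarith
  have hbound : Tendsto (fun n : ℕ => 4 / (1 / 2 - (α : ℝ)) ^ 2 / n)
      (atTop ⊓ Filter.principal (exactSet α ξ)) (nhds 0) :=
    (tendsto_const_div_atTop_nhds_zero_nat _).mono_left inf_le_left
  refine ⟨fun ε hε => ?_, ?_⟩
  · have hb := hbound.div_const (ε ^ 2)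
    rw [zero_div] at hb
    refine tendsto_of_tendsto_of_tendsto_of_le_of_le' tendsto_const_nhds hb ?_ ?_
    · filter_upwards [hfacts] with n ⟨_, hlm, hmn, _⟩
      refine Finset.sum_nonneg fun x hx => ?_
      split_ifs
      · exact pSW_nonneg hlm hmn (Nat.lt_succ_iff.mp (Finset.mem_range.mp hx))
      · exact le_rfl
    · filter_upwards [hfacts] with n ⟨_, hlm, hmn, h⟩
      refine (sum_ite_le_sum_sq_div (fun x hx =>
        pSW_nonneg hlm hmn (Nat.lt_succ_iff.mp (Finset.mem_range.mp hx))) hε).trans ?_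
      gcongr
  · have hb := hbound.sqrt
    rw [Real.sqrt_zero] at hb
    refine squeeze_zero_norm' ?_ hb
    filter_upwards [hfacts] with n ⟨hn, hlm, hmn, h⟩
    have hn0 : (n : ℝ) ≠ 0 := by positivity
    have s0 := sum_pSW hlm hmn
    have e : ((∑ x ∈ Finset.range (ratIdx α n + 1),
        (x : ℝ) * pSW n (ratIdx ξ n) (ratIdx α n) x) - n * μ) / n =
        ∑ x ∈ Finset.range (ratIdx α n + 1),
          ((x : ℝ) / n - μ) * pSW n (ratIdx ξ n) (ratIdx α n) x := by
      simp only [sub_mul, Finset.sum_sub_distrib]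
      rw [← Finset.mul_sum, s0, sub_div, Finset.sum_div, mul_one, mul_div_cancel_left₀ _ hn0]
      exact congrArg (· - μ) (Finset.sum_congr rfl fun x _ => by ring)
    rw [Real.norm_eq_abs, e]
    refine Real.abs_le_sqrt ((sq_sum_mul_le (fun x hx =>
      pSW_nonneg hlm hmn (Nat.lt_succ_iff.mp (Finset.mem_range.mp hx))) s0).trans h)
end

section
/- Fix rationals α, ξ with 0 < α < ξ ≤ 1/2, and set D := 1 − 4α(1−ξ), μ := (1 − √D)/2 and σ := √(α(ξ−α)(1−ξ)/D) (note D > 0). For each n such that l := αn and m := ξn are integers, let X_n be a random variable with probability mass function p_{n,m,l}. Then for all reals t < u, P(t ≤ (X_n − nμ)/(√n·σ) ≤ u) → (1/√(2π)) ∫_t^u e^{−s²/2} ds as n → ∞ along such n. -/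
section

open Filter Topology

/-- Stirling's formula in logarithmic form. -/
lemma tendsto_log_factorial_sub_stirling :
    Tendsto (fun k : ℕ => Real.log (k.factorial : ℝ) -
      (k * Real.log k - k + Real.log (2 * Real.pi * k) / 2)) atTop (𝓝 0) := by
  have h := (Stirling.tendsto_stirlingSeq_sqrt_pi.log (by positivity)).sub_const
    (Real.log (Real.sqrt Real.pi))
  rw [sub_self] at h
  refine h.congr' ?_
  filter_upwards [eventually_gt_atTop 0] with k hk
  have hk' : (0 : ℝ) < k := by exact_mod_cast hk
  have hpi := Real.pi_pos
  rw [Stirling.log_stirlingSeq_formula, Real.log_sqrt hpi.le,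
    Real.log_div hk'.ne' (Real.exp_pos _).ne', Real.log_exp,
    Real.log_mul (by positivity) hk'.ne', Real.log_mul (by positivity) hk'.ne',
    Real.log_mul (by positivity) hpi.ne']
  ring

lemma abs_one_add_mul_log_one_add_sub_le {w : ℝ} (hw : |w| ≤ 1 / 2) :
    |(1 + w) * Real.log (1 + w) - w - w ^ 2 / 2| ≤ 4 * |w| ^ 3 := by
  have h := Real.abs_log_sub_add_sum_range_le (x := -w) (by rw [abs_neg]; linarith) 2
  rw [abs_neg, sub_neg_eq_add] at h
  simp only [Finset.sum_range_succ, Finset.sum_range_zero] at h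
  have h3 : |w| ^ (2 + 1) / (1 - |w|) ≤ 2 * |w| ^ 3 := by
    rw [div_le_iff₀ (by linarith)]
    have := mul_nonneg (pow_nonneg (abs_nonneg w) 3) (sub_nonneg.2 hw)
    have e : |w| ^ (2 + 1) = 2 * |w| ^ 3 * (1 - |w|) - 2 * (|w| ^ 3 * (1 / 2 - |w|)) := by ring
    exact e.le.trans (sub_le_self _ <| mul_nonneg zero_le_two this)
  have h4 := h.trans h3
  norm_num at h4
  set r := -w + w ^ 2 / 2 + Real.log (1 + w) with hr
  have e : (1 + w) * Real.log (1 + w) - w - w ^ 2 / 2 = (1 + w) * r - w ^ 3 / 2 := by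
    rw [hr]; ring
  rw [e]
  have h5 : |1 + w| ≤ 3 / 2 := by
    rw [abs_le] at hw ⊢; constructor <;> linarith [hw.1, hw.2]
  calc |(1 + w) * r - w ^ 3 / 2| ≤ |(1 + w) * r| + |w ^ 3 / 2| := abs_sub _ _
    _ = |1 + w| * |r| + |w| ^ 3 / 2 := by rw [abs_mul, abs_div, abs_pow]; norm_num
    _ ≤ 3 / 2 * (2 * |w| ^ 3) + |w| ^ 3 / 2 := by gcongr
    _ ≤ 4 * |w| ^ 3 := by nlinarith [pow_nonneg (abs_nonneg w) 3]

/-- Stirling's formula for `N! = (n (c + v))!` expanded to second order in the perturbation `v`,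
where `n * v ^ 2` stays bounded. -/
lemma tendsto_log_factorial_sub_expansion {ι : Type*} {L : Filter ι} {n N : ι → ℕ} {v : ι → ℝ}
    {c K : ℝ} (hc : 0 < c) (hn : Tendsto n L atTop) (hv : Tendsto v L (𝓝 0))
    (hK : ∀ᶠ i in L, n i * v i ^ 2 ≤ K) (hN : ∀ᶠ i in L, (N i : ℝ) = n i * (c + v i)) :
    Tendsto (fun i => Real.log ((N i).factorial : ℝ) -
      (n i * (c + v i) * Real.log (n i) - n i * (c + v i)
        + n i * (c * Real.log c + (Real.log c + 1) * v i + v i ^ 2 / (2 * c))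
        + (Real.log (2 * Real.pi) + Real.log c + Real.log (n i)) / 2)) L (𝓝 0) := by
  have hnR : Tendsto (fun i => (n i : ℝ)) L atTop := tendsto_natCast_atTop_atTop.comp hn
  have hcv : Tendsto (fun i => c + v i) L (𝓝 c) := by simpa using hv.const_add c
  have hNR : Tendsto (fun i => (N i : ℝ)) L atTop :=
    (hnR.atTop_mul_pos hc hcv).congr' (hN.mono fun i h => h.symm)
  have hNt : Tendsto N L atTop := tendsto_natCast_atTop_iff.1 hNR
  have h1 := tendsto_log_factorial_sub_stirling.comp hNt
  set w : ι → ℝ := fun i => v i / c with hw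
  have hw0 : Tendsto w L (𝓝 0) := by simpa using hv.div_const c
  have h2 : Tendsto (fun i => n i * c *
      ((1 + w i) * Real.log (1 + w i) - w i - w i ^ 2 / 2)) L (𝓝 0) := by
    have hb : Tendsto (fun i => 4 * (K / c) * |w i|) L (𝓝 0) := by
      simpa using hw0.abs.const_mul (4 * (K / c))
    refine squeeze_zero_norm' ?_ hb
    have hsmall : ∀ᶠ i in L, |w i| < 1 / 2 := by
      have := hw0.abs
      rw [abs_zero] at this
      exact this.eventually_lt_const (by norm_num)
    filter_upwards [hsmall, hK] with i hi hKi
    rw [Real.norm_eq_abs, abs_mul, abs_of_nonneg (by positivity : (0 : ℝ) ≤ n i * c)]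
    calc _ ≤ n i * c * (4 * |w i| ^ 3) := by
          gcongr; exact abs_one_add_mul_log_one_add_sub_le hi.le
      _ = 4 * (n i * v i ^ 2 / c) * |w i| := by
          have : |w i| ^ 3 = (v i / c) ^ 2 * |w i| := by rw [pow_succ, sq_abs]
          rw [this]; field_simp
      _ ≤ _ := by gcongr
  have h3 : Tendsto (fun i => Real.log (1 + w i) / 2) L (𝓝 0) := by
    have : Tendsto (fun i => 1 + w i) L (𝓝 1) := by simpa using hw0.const_add 1
    simpa using (this.log one_ne_zero).div_const 2
  have h4 := (h1.add h2).add h3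
  simp only [add_zero] at h4
  refine h4.congr' ?_
  filter_upwards [hN, hnR.eventually_gt_atTop 0,
    hcv.eventually_const_lt hc] with i hi hni hci
  have e : c + v i = c * (1 + w i) := by rw [hw]; field_simp
  have hwp : 0 < 1 + w i := by
    rw [e] at hci; exact (mul_pos_iff_of_pos_left hc).1 hci
  have hvw : v i = c * w i := by rw [hw]; field_simp
  have hpi := Real.pi_pos
  simp only [Function.comp, hi]
  rw [hvw, show c + c * w i = c * (1 + w i) by ring,
    Real.log_mul (by positivity : 2 * Real.pi ≠ 0) (by positivity),
    Real.log_mul hni.ne' (by positivity), Real.log_mul hc.ne' hwp.ne']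
  field_simp
  ring

lemma abs_mul_sub_integral_le {g : ℝ → ℝ} (hg : Continuous g) {a d ε : ℝ} (hd : 0 ≤ d)
    (h : ∀ s ∈ Set.Icc a (a + d), |g a - g s| ≤ ε) :
    |d * g a - ∫ s in a..a + d, g s| ≤ ε * d := by
  have e : d * g a - ∫ s in a..a + d, g s = ∫ s in a..a + d, (g a - g s) := by
    rw [intervalIntegral.integral_sub (by simp) (hg.intervalIntegrable _ _),
      intervalIntegral.integral_const]
    simp
  rw [e]
  have := intervalIntegral.norm_integral_le_of_norm_le_const (a := a) (b := a + d)
    (f := fun s => g a - g s) (C := ε) (fun s hs => by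
      rw [Set.uIoc_of_le (by linarith)] at hs
      exact h s ⟨hs.1.le, hs.2⟩)
  simpa [abs_of_nonneg hd] using this

/-- Sums of a lattice function that is uniformly close to `δ * g` on `[t, u]`, for lattices of
mesh `δ → 0`, converge to the integral of `g`. -/
lemma tendsto_sum_of_local_limit {F : Filter ℕ} {δ c : ℕ → ℝ} {P : ℕ → ℕ → ℝ}
    {S : ℕ → Finset ℕ} {g : ℝ → ℝ} {t u : ℝ} (htu : t < u) (hg : Continuous g)
    (hδ : ∀ᶠ n in F, 0 < δ n) (hδ0 : Tendsto δ F (𝓝 0))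
    (hpos : ∀ᶠ n in F, 0 < c n + t / δ n)
    (hS : ∀ᶠ n in F, ∀ x, x ∈ S n ↔ t ≤ (x - c n) * δ n ∧ (x - c n) * δ n ≤ u)
    (hP : ∀ ε > 0, ∀ᶠ n in F, ∀ x : ℕ, t ≤ (x - c n) * δ n → (x - c n) * δ n ≤ u →
      |P n x - δ n * g ((x - c n) * δ n)| ≤ ε * δ n) :
    Tendsto (fun n => ∑ x ∈ S n, P n x) F (𝓝 (∫ s in t..u, g s)) := by
  set s : ℕ → ℕ → ℝ := fun n x => (x - c n) * δ n with hs
  set a : ℕ → ℕ := fun n => ⌈c n + t / δ n⌉₊ with ha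
  set b : ℕ → ℕ := fun n => ⌊c n + u / δ n⌋₊ + 1 with hb
  have hsucc : ∀ n x, s n (x + 1) = s n x + δ n := by
    intro n x; simp only [hs]; push_cast; ring
  have hle : ∀ᶠ n in F, c n + t / δ n < c n + u / δ n := by
    filter_upwards [hδ] with n h1
    gcongr
  have hsa : ∀ᶠ n in F, t ≤ s n (a n) ∧ s n (a n) ≤ t + δ n := by
    filter_upwards [hδ, hpos] with n h1 h2
    have h3 := Nat.le_ceil (c n + t / δ n)
    have h4 := (Nat.ceil_lt_add_one h2.le).le
    have e : t = (c n + t / δ n - c n) * δ n := by field_simp; ring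
    constructor
    · calc t = _ := e
        _ ≤ _ := by simp only [hs, ha]; gcongr
    · calc s n (a n) ≤ (c n + t / δ n + 1 - c n) * δ n := by simp only [hs, ha]; gcongr
        _ = _ := by field_simp; ring
  have hsb : ∀ᶠ n in F, u ≤ s n (b n) ∧ s n (b n) ≤ u + δ n := by
    filter_upwards [hδ, hpos, hle] with n h1 h2 h2'
    have h3 := (Nat.lt_floor_add_one (c n + u / δ n)).le
    have h4 := Nat.floor_le (h2.trans h2').le
    have e : u = (c n + u / δ n - c n) * δ n := by field_simp; ring
    constructor
    · calc u = _ := e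
        _ ≤ _ := by simp only [hs, hb]; push_cast; gcongr
    · calc s n (b n) ≤ (c n + u / δ n + 1 - c n) * δ n := by
            simp only [hs, hb]; push_cast; gcongr
        _ = _ := by field_simp; ring
  have hab : ∀ᶠ n in F, a n ≤ b n := by
    filter_upwards [hδ, hpos, hle] with n h1 h2 h2'
    exact (Nat.ceil_le_floor_add_one _).trans (by simp only [hb]; gcongr)
  have hSI : ∀ᶠ n in F, S n = Finset.Ico (a n) (b n) := by
    filter_upwards [hδ, hpos, hle, hS] with n h1 h2 h2' h3
    ext x
    rw [h3, Finset.mem_Ico, Nat.ceil_le, Nat.lt_succ_iff, Nat.le_floor_iff (h2.trans h2').le,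
      ← div_le_iff₀ h1, ← le_div_iff₀ h1]
    constructor <;> rintro ⟨h4, h5⟩ <;> constructor <;> linarith
  have htδ : Tendsto (fun n => t + δ n) F (𝓝 t) := by simpa using hδ0.const_add t
  have huδ : Tendsto (fun n => u + δ n) F (𝓝 u) := by simpa using hδ0.const_add u
  have hta : Tendsto (fun n => s n (a n)) F (𝓝 t) :=
    tendsto_of_tendsto_of_tendsto_of_le_of_le' tendsto_const_nhds htδ
      (hsa.mono fun n h => h.1) (hsa.mono fun n h => h.2)
  have htb : Tendsto (fun n => s n (b n)) F (𝓝 u) :=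
    tendsto_of_tendsto_of_tendsto_of_le_of_le' tendsto_const_nhds huδ
      (hsb.mono fun n h => h.1) (hsb.mono fun n h => h.2)
  have hint : Tendsto (fun n => ∫ s in s n (a n)..s n (b n), g s) F (𝓝 (∫ s in t..u, g s)) := by
    have hc0 : Continuous fun z => ∫ s in (0 : ℝ)..z, g s :=
      intervalIntegral.continuous_primitive (fun a b => hg.intervalIntegrable a b) 0
    have := ((hc0.tendsto u).comp htb).sub ((hc0.tendsto t).comp hta)
    simp only [Function.comp_def, intervalIntegral.integral_interval_sub_left
      (hg.intervalIntegrable _ _) (hg.intervalIntegrable _ _)] at this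
    exact this
  suffices h : Tendsto (fun n => ∑ x ∈ S n, P n x - ∫ s in s n (a n)..s n (b n), g s) F (𝓝 0) by
    simpa using h.add hint
  rw [Metric.tendsto_nhds]
  intro ε hε
  set η := ε / (4 * (u - t + 1)) with hη
  have hut : 0 < u - t + 1 := by linarith
  have hη0 : 0 < η := by positivity
  have huc := (isCompact_Icc (a := t) (b := u + 1)).uniformContinuousOn_of_continuous
    hg.continuousOn
  obtain ⟨ρ, hρ, huc⟩ := Metric.uniformContinuousOn_iff_le.1 huc η hη0
  filter_upwards [hδ, hSI, hab, hsa, hsb, hP η hη0, hS,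
    hδ0.eventually_lt_const (show (0 : ℝ) < min ρ 1 by positivity)]
    with n h1 h2 h3 h4 h5 h6 h7 h8
  have h8a := h8.trans_le (min_le_left _ _)
  have h8b := h8.trans_le (min_le_right _ _)
  have hsum := intervalIntegral.sum_integral_adjacent_intervals_Ico (a := s n) (f := g)
    (μ := MeasureTheory.volume) h3 (fun k _ => hg.intervalIntegrable _ _)
  rw [Real.dist_eq, sub_zero, ← hsum, h2, ← Finset.sum_sub_distrib]
  have hterm : ∀ x ∈ Finset.Ico (a n) (b n),
      |P n x - ∫ s in s n x..s n (x + 1), g s| ≤ 2 * η * δ n := by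
    intro x hx
    rw [← h2, h7] at hx
    have k1 := h6 x hx.1 hx.2
    have k2 := abs_mul_sub_integral_le hg (a := s n x) (d := δ n) (ε := η) h1.le (by
      intro z hz
      have := huc (s n x) ⟨hx.1, by linarith [hx.2]⟩ z
        ⟨hx.1.trans hz.1, by linarith [hz.2, hx.2]⟩ (by
          rw [Real.dist_eq, abs_le]; constructor <;> linarith [hz.1, hz.2])
      rwa [Real.dist_eq] at this)
    rw [hsucc]
    have k3 := abs_add_le (P n x - δ n * g (s n x)) (δ n * g (s n x) - ∫ s in s n x..s n x + δ n, g s)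
    rw [sub_add_sub_cancel] at k3
    linarith
  have hcard : ((b n : ℝ) - a n) * δ n ≤ u - t + 1 := by
    have : ((b n : ℝ) - a n) * δ n = s n (b n) - s n (a n) := by simp only [hs]; ring
    rw [this]; linarith [h4.1, h5.2]
  calc _ ≤ ∑ x ∈ Finset.Ico (a n) (b n), |P n x - ∫ s in s n x..s n (x + 1), g s| :=
        Finset.abs_sum_le_sum_abs _ _
    _ ≤ ∑ x ∈ Finset.Ico (a n) (b n), 2 * η * δ n := Finset.sum_le_sum hterm
    _ = 2 * η * (((b n : ℝ) - a n) * δ n) := by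
        rw [Finset.sum_const, Nat.card_Ico, nsmul_eq_mul, Nat.cast_sub h3]; ring
    _ ≤ 2 * η * (u - t + 1) := by gcongr
    _ < ε := by rw [hη]; field_simp; linarith

lemma pSW_eq_factorial {n m l x : ℕ} (hx : x ≤ l) (hl : l ≤ m) (hm : 2 * m ≤ n) :
    pSW n m l x = ((n - m).factorial * l.factorial * (m - x).factorial * (n - l - x).factorial) /
      (x.factorial * (n - x).factorial * (l - x).factorial * (m - l).factorial *
        (n - m - x).factorial : ℝ) * (((n : ℝ) - 2 * x + 1) / ((n : ℝ) - x + 1)) := by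
  have hf : ∀ k : ℕ, (k.factorial : ℝ) ≠ 0 := fun k => by exact_mod_cast k.factorial_ne_zero
  have e : n - l - x - (m - l) = n - m - x := by omega
  rw [pSW, Nat.cast_choose ℝ (by omega : x ≤ n), Nat.cast_choose ℝ (by omega : m ≤ n),
    Nat.cast_choose ℝ hx, Nat.cast_choose ℝ (by omega : x ≤ m),
    Nat.cast_choose ℝ (by omega : m - l ≤ n - l - x), e, mul_right_comm]
  congr 1
  have h1 := hf n
  have h2 := hf m
  have h3 := hf l
  have h4 := hf x
  have h5 := hf (n - x)
  have h6 := hf (n - m)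
  have h7 := hf (l - x)
  have h8 := hf (m - x)
  have h9 := hf (m - l)
  have h10 := hf (n - m - x)
  field_simp

lemma pSW_pos {n m l x : ℕ} (hx : x ≤ l) (hl : l ≤ m) (hm : 2 * m ≤ n) : 0 < pSW n m l x := by
  have hf : ∀ k : ℕ, (0 : ℝ) < k.factorial := fun k => by exact_mod_cast k.factorial_pos
  have h : (2 * x : ℝ) ≤ n := by exact_mod_cast (by omega : 2 * x ≤ n)
  have h0 : (0 : ℝ) ≤ x := x.cast_nonneg
  have h1 : 0 < (n : ℝ) - 2 * x + 1 := by linarith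
  have h2 : 0 < (n : ℝ) - x + 1 := by linarith
  rw [pSW_eq_factorial hx hl hm]
  have := hf l
  have := hf x
  have := hf (n - x)
  have := hf (n - m)
  have := hf (l - x)
  have := hf (m - x)
  have := hf (m - l)
  have := hf (n - l - x)
  have := hf (n - m - x)
  positivity

lemma log_pSW {n m l x : ℕ} (hx : x ≤ l) (hl : l ≤ m) (hm : 2 * m ≤ n) :
    Real.log (pSW n m l x) =
      Real.log (n - m).factorial + Real.log l.factorial + Real.log (m - x).factorial
      + Real.log (n - l - x).factorial - Real.log x.factorial - Real.log (n - x).factorial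
      - Real.log (l - x).factorial - Real.log (m - l).factorial - Real.log (n - m - x).factorial
      + Real.log (((n : ℝ) - 2 * x + 1) / ((n : ℝ) - x + 1)) := by
  have hf : ∀ k : ℕ, (k.factorial : ℝ) ≠ 0 := fun k => by exact_mod_cast k.factorial_ne_zero
  have h : (2 * x : ℝ) ≤ n := by exact_mod_cast (by omega : 2 * x ≤ n)
  have h0 : (0 : ℝ) ≤ x := x.cast_nonneg
  have h1 : 0 < (n : ℝ) - 2 * x + 1 := by linarith
  have h2 : 0 < (n : ℝ) - x + 1 := by linarith
  have g1 := hf l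
  have g2 := hf x
  have g3 := hf (n - x)
  have g4 := hf (n - m)
  have g5 := hf (l - x)
  have g6 := hf (m - x)
  have g7 := hf (m - l)
  have g8 := hf (n - l - x)
  have g9 := hf (n - m - x)
  rw [pSW_eq_factorial hx hl hm, Real.log_mul (by positivity) (by positivity),
    Real.log_div (by positivity) (by positivity)]
  rw [Real.log_mul (by positivity) g8, Real.log_mul (by positivity) g6, Real.log_mul g4 g1,
    Real.log_mul (by positivity) g9, Real.log_mul (by positivity) g7,
    Real.log_mul (by positivity) g5, Real.log_mul g2 g3]
  ring

/-- Local central limit theorem for `pSW`, in logarithmic form. -/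
lemma tendsto_log_pSW {ι : Type*} {L : Filter ι} {n m l x : ι → ℕ} {α ξ μ σ K : ℝ}
    (hα : 0 < α) (hαξ : α < ξ) (hξ : ξ ≤ 1 / 2) (hμ0 : 0 < μ) (hμα : μ < α)
    (hμ : μ * (1 - μ) = α * (1 - ξ))
    (hσ2 : σ ^ 2 = α * (ξ - α) * (1 - ξ) / (1 - 2 * μ) ^ 2)
    (hn : Tendsto n L atTop) (hl : ∀ᶠ i in L, (l i : ℝ) = α * n i)
    (hm : ∀ᶠ i in L, (m i : ℝ) = ξ * n i)
    (hK : ∀ᶠ i in L, (n i : ℝ) * ((x i : ℝ) / n i - μ) ^ 2 ≤ K) :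
    (∀ᶠ i in L, x i ≤ l i ∧ l i ≤ m i ∧ 2 * m i ≤ n i) ∧
    Tendsto (fun i => Real.log (pSW (n i) (m i) (l i) (x i)) + Real.log (n i) / 2 + Real.log σ
      + Real.log (2 * Real.pi) / 2 + n i * ((x i : ℝ) / n i - μ) ^ 2 / (2 * σ ^ 2)) L (𝓝 0) := by
  set v : ι → ℝ := fun i => (x i : ℝ) / n i - μ with hvdef
  have hnR : Tendsto (fun i => (n i : ℝ)) L atTop := tendsto_natCast_atTop_atTop.comp hn
  have hnpos : ∀ᶠ i in L, (0 : ℝ) < n i := hnR.eventually_gt_atTop 0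
  have hv2 : Tendsto (fun i => v i ^ 2) L (𝓝 0) := by
    refine tendsto_of_tendsto_of_tendsto_of_le_of_le' tendsto_const_nhds
      (hnR.const_div_atTop K) (Eventually.of_forall fun i => sq_nonneg _) ?_
    filter_upwards [hK, hnpos] with i h1 h2
    rw [le_div_iff₀ h2]; linarith
  have hv : Tendsto v L (𝓝 0) := by
    rw [tendsto_zero_iff_abs_tendsto_zero]
    have := hv2.sqrt
    simpa [Function.comp_def, Real.sqrt_sq_eq_abs] using this
  have hxn : ∀ᶠ i in L, (x i : ℝ) = n i * (μ + v i) := by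
    filter_upwards [hnpos] with i h
    simp only [hvdef]; field_simp; ring
  have hord : ∀ᶠ i in L, x i ≤ l i ∧ l i ≤ m i ∧ 2 * m i ≤ n i := by
    filter_upwards [hxn, hl, hm, hnpos, hv.eventually_lt_const (sub_pos.2 hμα)]
      with i h1 h2 h3 h4 h5
    refine ⟨?_, ?_, ?_⟩
    · have : (x i : ℝ) ≤ l i := by rw [h1, h2]; nlinarith
      exact_mod_cast this
    · have : (l i : ℝ) ≤ m i := by rw [h3, h2]; nlinarith
      exact_mod_cast this
    · have : (2 * m i : ℝ) ≤ n i := by rw [h3]; nlinarith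
      exact_mod_cast this
  refine ⟨hord, ?_⟩
  have hvn : Tendsto (fun i => -v i) L (𝓝 0) := by simpa using hv.neg
  have hKn : ∀ᶠ i in L, (n i : ℝ) * (-v i) ^ 2 ≤ K := by simpa only [neg_sq] using hK
  have hz : Tendsto (fun _ : ι => (0 : ℝ)) L (𝓝 0) := tendsto_const_nhds
  have hKz : ∀ᶠ i in L, (n i : ℝ) * (0 : ℝ) ^ 2 ≤ K := by
    filter_upwards [hK] with i h
    refine le_trans ?_ h
    rw [zero_pow two_ne_zero, mul_zero]
    positivity
  have p1 : 0 < 1 - μ := by linarith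
  have p2 : 0 < α - μ := by linarith
  have p3 : 0 < 1 - α - μ := by linarith
  have p4 : 0 < 1 - 2 * μ := by linarith
  have p5 : 0 < 1 - ξ := by linarith
  have p6 : 0 < ξ - μ := by linarith
  have p7 : 0 < ξ - α := by linarith
  have p8 : 0 < 1 - ξ - μ := by linarith
  have T1 := tendsto_log_factorial_sub_expansion (N := fun i => n i - m i) p5 hn hz hKz (by
    filter_upwards [hxn, hl, hm, hord] with i h1 h2 h3 h4
    rw [Nat.cast_sub (by omega), h3]; ring)
  have T2 := tendsto_log_factorial_sub_expansion (N := l) hα hn hz hKz (by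
    filter_upwards [hl] with i h2
    rw [h2]; ring)
  have T3 := tendsto_log_factorial_sub_expansion (N := fun i => m i - x i) p6 hn hvn hKn (by
    filter_upwards [hxn, hl, hm, hord] with i h1 h2 h3 h4
    rw [Nat.cast_sub (by omega), h3, h1]; ring)
  have T4 := tendsto_log_factorial_sub_expansion (N := fun i => n i - l i - x i) p3 hn hvn hKn (by
    filter_upwards [hxn, hl, hm, hord] with i h1 h2 h3 h4
    rw [Nat.cast_sub (by omega), Nat.cast_sub (by omega), h2, h1]; ring)
  have T5 := tendsto_log_factorial_sub_expansion (N := x) hμ0 hn hv hK hxn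
  have T6 := tendsto_log_factorial_sub_expansion (N := fun i => n i - x i) p1 hn hvn hKn (by
    filter_upwards [hxn, hl, hm, hord] with i h1 h2 h3 h4
    rw [Nat.cast_sub (by omega), h1]; ring)
  have T7 := tendsto_log_factorial_sub_expansion (N := fun i => l i - x i) p2 hn hvn hKn (by
    filter_upwards [hxn, hl, hm, hord] with i h1 h2 h3 h4
    rw [Nat.cast_sub (by omega), h2, h1]; ring)
  have T8 := tendsto_log_factorial_sub_expansion (N := fun i => m i - l i) p7 hn hz hKz (by
    filter_upwards [hxn, hl, hm, hord] with i h1 h2 h3 h4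
    rw [Nat.cast_sub (by omega), h3, h2]; ring)
  have T9 := tendsto_log_factorial_sub_expansion (N := fun i => n i - m i - x i) p8 hn hvn hKn (by
    filter_upwards [hxn, hl, hm, hord] with i h1 h2 h3 h4
    rw [Nat.cast_sub (by omega), Nat.cast_sub (by omega), h3, h1]; ring)
  have T10 : Tendsto (fun i => Real.log (((n i : ℝ) - 2 * x i + 1) / ((n i : ℝ) - x i + 1))
      - (Real.log (1 - 2 * μ) - Real.log (1 - μ))) L (𝓝 0) := by
    have hinv : Tendsto (fun i => 1 / (n i : ℝ)) L (𝓝 0) := hnR.const_div_atTop 1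
    have hnum : Tendsto (fun i => 1 - 2 * (μ + v i) + 1 / (n i : ℝ)) L (𝓝 (1 - 2 * μ)) := by
      simpa using (((hv.const_add μ).const_mul 2).const_sub 1).add hinv
    have hden : Tendsto (fun i => 1 - (μ + v i) + 1 / (n i : ℝ)) L (𝓝 (1 - μ)) := by
      simpa using ((hv.const_add μ).const_sub 1).add hinv
    have h := ((hnum.div hden p1.ne').log (div_pos p4 p1).ne').sub_const
      (Real.log ((1 - 2 * μ) / (1 - μ)))
    rw [sub_self] at h
    refine h.congr' ?_
    filter_upwards [hxn, hnpos, hden.eventually_const_lt p1] with i h1 h2 h3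
    rw [Real.log_div p4.ne' p1.ne', h1]
    congr 2
    rw [Pi.div_apply, ← mul_div_mul_left _ _ h2.ne']
    congr 1 <;> field_simp
  have key := ((((((((T1.add T2).add T3).add T4).sub T5).sub T6).sub T7).sub T8).sub T9).add T10
  simp only [add_zero, sub_zero] at key
  refine key.congr' ?_
  have e1 : 1 - ξ = μ * (1 - μ) / α := by rw [eq_div_iff hα.ne', hμ]; ring
  have e2 : ξ - μ = (1 - μ) * (α - μ) / α := by
    rw [eq_div_iff hα.ne']; linear_combination hμ
  have e3 : 1 - ξ - μ = μ * (1 - α - μ) / α := by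
    rw [eq_div_iff hα.ne']; linear_combination -hμ
  have e4 : ξ - α = (α - μ) * (1 - α - μ) / α := by
    rw [eq_div_iff hα.ne']; linear_combination hμ
  have q2 : σ ^ 2 = μ * (1 - μ) * ((α - μ) * (1 - α - μ)) / (α * (1 - 2 * μ) ^ 2) := by
    rw [hσ2, e4, e1]; field_simp
  have hq : 1 / (ξ - μ) + 1 / (1 - α - μ) - 1 / μ - 1 / (1 - μ) - 1 / (α - μ) - 1 / (1 - ξ - μ)
      = - (1 / σ ^ 2) := by
    rw [e2, e3, q2]; field_simp; ring
  have l1 : Real.log (1 - ξ) = Real.log μ + Real.log (1 - μ) - Real.log α := by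
    rw [e1, Real.log_div (by positivity) hα.ne', Real.log_mul hμ0.ne' p1.ne']
  have l2 : Real.log (ξ - μ) = Real.log (1 - μ) + Real.log (α - μ) - Real.log α := by
    rw [e2, Real.log_div (by positivity) hα.ne', Real.log_mul p1.ne' p2.ne']
  have l3 : Real.log (1 - ξ - μ) = Real.log μ + Real.log (1 - α - μ) - Real.log α := by
    rw [e3, Real.log_div (by positivity) hα.ne', Real.log_mul hμ0.ne' p3.ne']
  have l4 : Real.log (ξ - α) = Real.log (α - μ) + Real.log (1 - α - μ) - Real.log α := by
    rw [e4, Real.log_div (by positivity) hα.ne', Real.log_mul p2.ne' p3.ne']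
  have l5 : Real.log σ = (Real.log μ + Real.log (1 - μ) + Real.log (α - μ)
      + Real.log (1 - α - μ) - Real.log α) / 2 - Real.log (1 - 2 * μ) := by
    have h := congrArg Real.log q2
    rw [Real.log_pow, Real.log_div (by positivity) (by positivity),
      Real.log_mul (by positivity) (by positivity), Real.log_mul hμ0.ne' p1.ne',
      Real.log_mul p2.ne' p3.ne', Real.log_mul hα.ne' (by positivity), Real.log_pow] at h
    push_cast at h
    linarith
  filter_upwards [hord] with i hi
  have hd : ∀ c : ℝ, v i ^ 2 / (2 * c) = v i ^ 2 / 2 * (1 / c) := fun c => by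
    rw [div_mul_div_comm, mul_one]
  rw [log_pSW hi.1 hi.2.1 hi.2.2]
  simp only [neg_sq, hd]
  rw [l1, l2, l3, l4, l5]
  linear_combination (-(n i * v i ^ 2 / 2)) * hq

end

open Filter in
/-- central limit theorem for `p_{n,m,l}`, Type II limit with
`k = l`: `(X_n − nμ)/(√n σ)` is asymptotically standard normal along those `n`
for which `αn` and `ξn` are integers. -/
theorem statement_12 (α ξ : ℚ) (h0 : 0 < α) (h1 : α < ξ) (h2 : ξ ≤ 1 / 2)
    (D μ σ : ℝ) (hD : D = 1 - 4 * (α : ℝ) * (1 - (ξ : ℝ)))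
    (hμ : μ = (1 - Real.sqrt D) / 2)
    (hσ : σ = Real.sqrt ((α : ℝ) * ((ξ : ℝ) - (α : ℝ)) * (1 - (ξ : ℝ)) / D))
    (t u : ℝ) (htu : t < u) :
    Tendsto (fun n : ℕ =>
        ∑ x ∈ Finset.range (ratIdx α n + 1),
          if t ≤ ((x : ℝ) - n * μ) / (Real.sqrt n * σ) ∧
              ((x : ℝ) - n * μ) / (Real.sqrt n * σ) ≤ u
          then pSW n (ratIdx ξ n) (ratIdx α n) x else 0)
      (atTop ⊓ Filter.principal (exactSet α ξ))
      (nhds ((1 / Real.sqrt (2 * Real.pi)) * ∫ s in t..u, Real.exp (-s ^ 2 / 2))) := by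
  have hα : (0 : ℝ) < α := by exact_mod_cast h0
  have hαξ : (α : ℝ) < ξ := by exact_mod_cast h1
  have hξ : (ξ : ℝ) ≤ 1 / 2 := by
    have : ((ξ : ℚ) : ℝ) ≤ ((1 / 2 : ℚ) : ℝ) := by exact_mod_cast h2
    simpa using this
  have hD0 : 0 < D := by rw [hD]; nlinarith
  have hD1 : D < 1 := by rw [hD]; nlinarith
  have hsq : Real.sqrt D ^ 2 = D := Real.sq_sqrt hD0.le
  have hsD : Real.sqrt D = 1 - 2 * μ := by rw [hμ]; ring
  have hμ2 : μ < 1 / 2 := by have := Real.sqrt_pos.2 hD0; linarith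
  have hμ0 : 0 < μ := by
    have : Real.sqrt D < 1 := by rw [Real.sqrt_lt' one_pos]; linarith
    linarith
  rw [hsD] at hsq
  have hμe : μ * (1 - μ) = α * (1 - ξ) := by linarith
  have hμα : μ < α := by
    by_contra! h
    nlinarith
  have hσ2pos : 0 < (α : ℝ) * (ξ - α) * (1 - ξ) / D :=
    div_pos (mul_pos (mul_pos hα (by linarith)) (by linarith)) hD0
  have hσ0 : 0 < σ := by rw [hσ]; exact Real.sqrt_pos.2 hσ2pos
  have hσ2 : σ ^ 2 = α * (ξ - α) * (1 - ξ) / (1 - 2 * μ) ^ 2 := by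
    rw [hσ, Real.sq_sqrt hσ2pos.le, hsq]
  set F : Filter ℕ := atTop ⊓ principal (exactSet α ξ) with hF
  have hFt : Tendsto (fun n : ℕ => n) F atTop := tendsto_id.mono_left inf_le_left
  have hFR : Tendsto (fun n : ℕ => (n : ℝ)) F atTop := tendsto_natCast_atTop_atTop.comp hFt
  have hFs : Tendsto (fun n : ℕ => Real.sqrt n) F atTop := Real.tendsto_sqrt_atTop.comp hFR
  have hFe : ∀ᶠ n in F, (ratIdx α n : ℝ) = α * n ∧ (ratIdx ξ n : ℝ) = ξ * n := by
    filter_upwards [show exactSet α ξ ∈ F from mem_inf_of_right (mem_principal_self _)]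
      with n hn
    exact ⟨by exact_mod_cast congrArg (fun q : ℚ => (q : ℝ)) hn.1,
      by exact_mod_cast congrArg (fun q : ℚ => (q : ℝ)) hn.2⟩
  set W : Set (ℕ × ℕ) := {p | t ≤ ((p.2 : ℝ) - p.1 * μ) / (Real.sqrt p.1 * σ) ∧
    ((p.2 : ℝ) - p.1 * μ) / (Real.sqrt p.1 * σ) ≤ u} with hW
  set L : Filter (ℕ × ℕ) := comap Prod.fst F ⊓ principal W with hL
  have hLF : Tendsto Prod.fst L F := tendsto_comap.mono_left inf_le_left
  have hLW : ∀ᶠ p in L, p ∈ W := mem_inf_of_right (mem_principal_self _)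
  have hdev : ∀ n x : ℕ, (0 : ℝ) < n → (n : ℝ) * ((x : ℝ) / n - μ) ^ 2
      = (((x : ℝ) - n * μ) / (Real.sqrt n * σ)) ^ 2 * σ ^ 2 := by
    intro n x hn
    rw [div_pow, mul_pow, Real.sq_sqrt hn.le]
    field_simp
  obtain ⟨hord, hlim⟩ := tendsto_log_pSW (L := L) (n := Prod.fst) (m := fun p => ratIdx ξ p.1)
    (l := fun p => ratIdx α p.1) (x := Prod.snd) (K := max |t| |u| ^ 2 * σ ^ 2)
    hα hαξ hξ hμ0 hμα hμe hσ2 (hFt.comp hLF)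
    (hLF.eventually (hFe.mono fun n h => h.1)) (hLF.eventually (hFe.mono fun n h => h.2)) (by
      filter_upwards [hLW, hLF.eventually (hFR.eventually_gt_atTop 0)] with p hp hp0
      rw [hdev _ _ hp0]
      refine mul_le_mul_of_nonneg_right ?_ (sq_nonneg _)
      rw [← sq_abs]
      gcongr
      exact abs_le_max_abs_abs hp.1 hp.2)
  have hpw : ∀ {Q : ℕ × ℕ → Prop}, (∀ᶠ p in L, Q p) → ∀ᶠ n in F, ∀ x, (n, x) ∈ W → Q (n, x) := by
    intro Q hQ
    rw [hL, eventually_inf_principal, eventually_comap] at hQ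
    exact hQ.mono fun n hn x hx => hn (n, x) rfl hx
  have hexp := (Real.continuous_exp.tendsto 0).comp hlim
  rw [Real.exp_zero] at hexp
  rw [← intervalIntegral.integral_const_mul]
  simp only [← Finset.sum_filter]
  refine tendsto_sum_of_local_limit (δ := fun n => (Real.sqrt n * σ)⁻¹) (c := fun n => n * μ)
    htu (by fun_prop) ?_ ?_ ?_ ?_ ?_
  · filter_upwards [hFs.eventually_gt_atTop 0] with n hn
    positivity
  · exact (hFs.atTop_mul_const hσ0).inv_tendsto_atTop
  · have h : Tendsto (fun n : ℕ => Real.sqrt n * (Real.sqrt n * μ + t * σ)) F atTop :=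
      hFs.atTop_mul_atTop₀ (tendsto_atTop_add_const_right _ _ (hFs.atTop_mul_const hμ0))
    filter_upwards [h.eventually_gt_atTop 0] with n hn
    have := Real.mul_self_sqrt (Nat.cast_nonneg (α := ℝ) n)
    rw [div_inv_eq_mul]
    calc 0 < _ := hn
      _ = (Real.sqrt n * Real.sqrt n) * μ + t * (Real.sqrt n * σ) := by ring
      _ = _ := by rw [this]
  · filter_upwards [hpw hord] with n hn x
    rw [Finset.mem_filter, Finset.mem_range, Nat.lt_succ_iff, ← div_eq_mul_inv]
    exact ⟨fun h => h.2, fun h => ⟨(hn x h).1, h⟩⟩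
  · intro ε hε
    have hE := hpw (hord.and (Metric.tendsto_nhds.1 hexp ε hε))
    filter_upwards [hE, hFR.eventually_gt_atTop 0] with n hn hn0 x hx1 hx2
    rw [← div_eq_mul_inv] at hx1 hx2 ⊢
    obtain ⟨⟨o1, o2, o3⟩, hd⟩ := hn x ⟨hx1, hx2⟩
    have hp := pSW_pos o1 o2 o3
    have hs := Real.sqrt_pos.2 hn0
    have h2pi : 0 < 2 * Real.pi := by positivity
    simp only [Function.comp, Real.dist_eq, hdev n x hn0] at hd
    set s := ((x : ℝ) - n * μ) / (Real.sqrt n * σ) with hsdef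
    have hEe : Real.exp (Real.log (pSW n (ratIdx ξ n) (ratIdx α n) x) + Real.log n / 2
        + Real.log σ + Real.log (2 * Real.pi) / 2 + s ^ 2 * σ ^ 2 / (2 * σ ^ 2))
        = pSW n (ratIdx ξ n) (ratIdx α n) x * Real.sqrt n * σ * Real.sqrt (2 * Real.pi)
          * Real.exp (s ^ 2 / 2) := by
      rw [← Real.log_sqrt hn0.le, ← Real.log_sqrt h2pi.le, Real.exp_add, Real.exp_add,
        Real.exp_add, Real.exp_add, Real.exp_log hp, Real.exp_log hs, Real.exp_log hσ0,
        Real.exp_log (Real.sqrt_pos.2 h2pi)]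
      congr 2
      field_simp
    rw [hEe] at hd
    set R := pSW n (ratIdx ξ n) (ratIdx α n) x * Real.sqrt n * σ * Real.sqrt (2 * Real.pi)
          * Real.exp (s ^ 2 / 2) with hR
    have hg0 : 0 ≤ 1 / Real.sqrt (2 * Real.pi) * Real.exp (-s ^ 2 / 2) := by positivity
    have hg1 : 1 / Real.sqrt (2 * Real.pi) * Real.exp (-s ^ 2 / 2) ≤ 1 := by
      refine mul_le_one₀ ?_ (Real.exp_pos _).le (Real.exp_le_one_iff.2 ?_)
      · rw [div_le_one (Real.sqrt_pos.2 h2pi), Real.one_le_sqrt]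
        linarith [Real.pi_gt_three]
      · have := sq_nonneg s
        linarith
    have e : pSW n (ratIdx ξ n) (ratIdx α n) x - (Real.sqrt n * σ)⁻¹ *
        (1 / Real.sqrt (2 * Real.pi) * Real.exp (-s ^ 2 / 2))
        = (Real.sqrt n * σ)⁻¹ * (1 / Real.sqrt (2 * Real.pi) * Real.exp (-s ^ 2 / 2)) * (R - 1) := by
      have := Real.sqrt_pos.2 h2pi
      have hx0 : Real.exp (-s ^ 2 / 2) * Real.exp (s ^ 2 / 2) = 1 := by
        rw [← Real.exp_add, neg_div, neg_add_cancel, Real.exp_zero]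
      have : (Real.sqrt n * σ)⁻¹ * (1 / Real.sqrt (2 * Real.pi) * Real.exp (-s ^ 2 / 2)) * R
          = pSW n (ratIdx ξ n) (ratIdx α n) x := by
        calc _ = pSW n (ratIdx ξ n) (ratIdx α n) x *
              (Real.exp (-s ^ 2 / 2) * Real.exp (s ^ 2 / 2)) := by rw [hR]; field_simp
          _ = _ := by rw [hx0, mul_one]
      rw [mul_sub, this, mul_one]
    rw [e, abs_mul, abs_of_nonneg (by positivity)]
    calc _ ≤ (Real.sqrt n * σ)⁻¹ * 1 * ε := by gcongr
      _ = _ := by ring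
end
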